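/- arXiv:2602.01190 — 10 statements merged into one kernel-verified Lean document; each statement's English description precedes it below -/
import Mathlib

section
/- Let A and B be Lebesgue measurable subsets of ℝ. If every Lebesgue null subset N of A can be translated into B (i.e., for every null N ⊆ A there exists x ∈ ℝ with N + x ⊆ B), then there exists a Lebesgue null set N₀ ⊆ A and a real number x such that (A \ N₀) + x ⊆ B. -/
open MeasureTheory Filter Set
open scoped Pointwise ENNReal Topology

theorem tendsto_setIntegral_cos_mul_atTop {S : Set ℝ} (hS : MeasurableSet S)
    (hfin : volume S ≠ ∞) :
    Tendsto (fun w : ℝ => ∫ t in S, Real.cos (w * t)) atTop (𝓝 0) := by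
  have hfreq : Tendsto (fun w : ℝ => w / (2 * Real.pi)) atTop (cocompact ℝ) :=
    (tendsto_id.atTop_div_const (by positivity)).mono_right atTop_le_cocompact
  have key := (Complex.continuous_re.tendsto 0).comp
    ((Real.tendsto_integral_exp_smul_cocompact (S.indicator (fun _ => (1 : ℂ)))).comp hfreq)
  rw [Complex.zero_re] at key
  refine key.congr fun w => ?_
  have hint : Integrable (S.indicator (fun _ => (1 : ℂ))) :=
    (integrable_indicator_iff hS).2 (integrableOn_const hfin)
  have hint' := (Real.fourierIntegral_convergent_iff (μ := volume) (w / (2 * Real.pi))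
    (f := S.indicator (fun _ => (1 : ℂ)))).2 hint
  simp only [RCLike.inner_apply, conj_trivial] at hint'
  simp only [Function.comp_apply]
  rw [← integral_indicator hS]
  simp only [mul_comm _ (w / (2 * Real.pi))]
  rw [← RCLike.re_eq_complex_re, ← integral_re hint']
  congr 1
  ext t
  by_cases ht : t ∈ S
  · simp only [ht, indicator_of_mem, Circle.smul_def, Real.fourierChar_apply, smul_eq_mul, mul_one]
    change (Complex.exp _).re = _
    rw [Complex.exp_ofReal_mul_I_re, ← Real.cos_neg]
    congr 1
    field_simp
  · simp [ht]

/-- If `R w` contains every `t` with `0 < σ * cos (w * t)`, where `σ = ±1`, then for large `w` it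
carries at least one eighth of the measure of `S`. -/
theorem eventually_measure_div_eight_le_inter {S : Set ℝ} (hS : MeasurableSet S)
    (hfin : volume S ≠ ∞) {σ : ℝ} (hσ : |σ| = 1) {R : ℝ → Set ℝ}
    (hR : ∀ w, MeasurableSet (R w)) (hneg : ∀ w, ∀ t ∉ R w, σ * Real.cos (w * t) ≤ 0) :
    ∀ᶠ w in atTop, volume S / 8 ≤ volume (S ∩ R w) := by
  rcases eq_or_ne (volume S) 0 with h0 | h0
  · simp [h0]
  have hpos : 0 < volume.real S := ENNReal.toReal_pos h0 hfin
  have h1 := tendsto_setIntegral_cos_mul_atTop hS hfin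
  have h2 : Tendsto (fun w : ℝ => ∫ t in S, Real.cos (2 * w * t)) atTop (𝓝 0) :=
    h1.comp (tendsto_id.const_mul_atTop two_pos)
  have hlim : Tendsto (fun w : ℝ => σ * (∫ t in S, Real.cos (w * t)) +
      ((∫ t in S, Real.cos (2 * w * t)) / 2 + volume.real S / 2)) atTop
      (𝓝 (σ * 0 + (0 / 2 + volume.real S / 2))) :=
    (h1.const_mul σ).add ((h2.div_const 2).add_const _)
  have hlt : volume.real S / 4 < σ * 0 + (0 / 2 + volume.real S / 2) := by linarith
  filter_upwards [hlim.eventually_const_lt hlt] with w hw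
  have : IsFiniteMeasure (volume.restrict S) := ⟨by simpa using hfin.lt_top⟩
  have hci : ∀ a : ℝ, IntegrableOn (fun t => Real.cos (a * t)) S := fun a =>
    Integrable.of_bound (by fun_prop) 1 (.of_forall fun t => by
      simpa using Real.abs_cos_le_one (a * t))
  have hind : IntegrableOn ((R w).indicator fun _ => (2 : ℝ)) S :=
    (integrable_const 2).indicator (hR w)
  have hle : ∫ t in S, (σ * Real.cos (w * t) + (Real.cos (2 * w * t) / 2 + 1 / 2)) ≤
      ∫ t in S, (R w).indicator (fun _ => (2 : ℝ)) t := by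
    refine integral_mono (((hci w).const_mul σ).add (((hci (2 * w)).div_const 2).add
      (integrable_const _))) hind fun t => ?_
    have hcos : Real.cos (2 * w * t) = 2 * Real.cos (w * t) ^ 2 - 1 := by
      rw [mul_assoc, Real.cos_two_mul]
    have hb := abs_le.1 (show |σ * Real.cos (w * t)| ≤ 1 by
      rw [abs_mul, hσ, one_mul]; exact Real.abs_cos_le_one _)
    have hsq : (σ * Real.cos (w * t)) ^ 2 = Real.cos (w * t) ^ 2 := by
      rw [mul_pow, ← sq_abs σ, hσ]; ring
    simp only [hcos]
    by_cases ht : t ∈ R w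
    · simp only [ht, indicator_of_mem]; nlinarith
    · have := hneg w t ht
      simp only [ht, not_false_eq_true, indicator_of_notMem]; nlinarith
  have heq : ∫ t in S, (σ * Real.cos (w * t) + (Real.cos (2 * w * t) / 2 + 1 / 2)) =
      σ * (∫ t in S, Real.cos (w * t)) +
        ((∫ t in S, Real.cos (2 * w * t)) / 2 + volume.real S / 2) := by
    have hi := ((hci (2 * w)).div_const 2).add (integrable_const (1 / 2 : ℝ))
    refine (integral_add ((hci w).const_mul σ) hi).trans ?_
    rw [integral_const_mul]
    congr 1
    refine (integral_add ((hci (2 * w)).div_const 2) (integrable_const _)).trans ?_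
    rw [integral_div, setIntegral_const, smul_eq_mul, mul_one_div]
  rw [heq, integral_indicator (hR w), setIntegral_const, measureReal_restrict_apply (hR w),
    inter_comm] at hle
  simp only [smul_eq_mul] at hle
  have hfin' : volume (S ∩ R w) ≠ ∞ := measure_ne_top_of_subset inter_subset_left hfin
  rw [← ENNReal.toReal_le_toReal (by finiteness) hfin', ENNReal.toReal_div]
  simp only [← measureReal_def]
  norm_num
  linarith

theorem tendsto_measure_symmDiff_add_preimage {C : Set ℝ} (hC : MeasurableSet C)
    (hfin : volume C ≠ ∞) (x : ℝ) :
    Tendsto (fun y => volume (symmDiff ((· + y) ⁻¹' C) ((· + x) ⁻¹' C))) (𝓝 x) (𝓝 0) := by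
  let F : C(ℝ, C(ℝ, ℝ)) := ContinuousMap.curry ⟨fun p : ℝ × ℝ => p.2 + p.1, by fun_prop⟩
  exact tendsto_measure_symmDiff_preimage_nhds_zero (f := F) (g := F x)
    (F.continuous.tendsto x) (.of_forall fun y => measurePreserving_add_right volume y)
    (measurePreserving_add_right volume x) hC.nullMeasurableSet hfin

theorem measure_inter_add_preimage_pos_of_symmDiff_lt {S C : Set ℝ} {x y : ℝ}
    (h : volume (symmDiff ((· + y) ⁻¹' C) ((· + x) ⁻¹' C)) < volume (S ∩ (· + x) ⁻¹' C)) :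
    0 < volume (S ∩ (· + y) ⁻¹' C) := by
  rw [pos_iff_ne_zero]
  intro h0
  refine h.not_ge ((measure_mono (t := S ∩ (· + y) ⁻¹' C ∪
    symmDiff ((· + y) ⁻¹' C) ((· + x) ⁻¹' C)) ?_).trans ((measure_union_le _ _).trans ?_))
  · rintro t ⟨htS, htx⟩
    by_cases hty : t ∈ (· + y) ⁻¹' C
    · exact Or.inl ⟨htS, hty⟩
    · exact Or.inr (Or.inr ⟨htx, hty⟩)
  · rw [h0, zero_add]

/-- A compact set meeting `C - y` in positive measure for all `y` in a compact set `K` can be shrunk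
by a definite factor while keeping this property. -/
theorem exists_isCompact_subset_measure_le_forall_inter_pos {A C K : Set ℝ} (hA : IsCompact A)
    (hC : IsCompact C) (hK : IsCompact K) (h : ∀ y ∈ K, 0 < volume (A ∩ (· + y) ⁻¹' C)) :
    ∃ A' ⊆ A, IsCompact A' ∧ volume A' ≤ (7 / 8) * volume A ∧
      ∀ y ∈ K, 0 < volume (A' ∩ (· + y) ⁻¹' C) := by
  have hcl : ∀ w : ℝ, IsClosed {t : ℝ | 0 ≤ Real.cos (w * t)} := fun w =>
    isClosed_le continuous_const (by fun_prop)
  have hpos : ∀ᶠ w : ℝ in atTop, ∀ y ∈ K,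
      0 < volume (A ∩ {t : ℝ | 0 ≤ Real.cos (w * t)} ∩ (· + y) ⁻¹' C) := by
    refine hK.induction_on (by simp) (fun s t hst ht => ht.mono fun w hw y hy => hw y (hst hy))
      (fun s t hs ht => ?_) fun x hx => ?_
    · filter_upwards [hs, ht] with w hws hwt y hy
      exact hy.elim (hws y) (hwt y)
    · have hmeas : MeasurableSet (A ∩ (· + x) ⁻¹' C) :=
        hA.measurableSet.inter (hC.measurableSet.preimage (measurable_add_const x))
      have hbig := eventually_measure_div_eight_le_inter hmeas
        (measure_ne_top_of_subset inter_subset_left hA.measure_ne_top) (σ := 1) (by simp)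
        (fun w => (hcl w).measurableSet) fun w t ht => by
          simpa using (not_le.1 ht).le
      refine ⟨_, mem_nhdsWithin_of_mem_nhds
        ((tendsto_measure_symmDiff_add_preimage hC.measurableSet hC.measure_ne_top
          x).eventually_lt_const (ENNReal.div_pos (h x hx).ne' (by simp : (8 : ℝ≥0∞) ≠ ∞))), ?_⟩
      filter_upwards [hbig] with w hw y hy
      rw [inter_right_comm] at hw
      exact measure_inter_add_preimage_pos_of_symmDiff_lt (lt_of_lt_of_le hy hw)
  have hsmall : ∀ᶠ w : ℝ in atTop,
      volume A / 8 ≤ volume (A ∩ {t : ℝ | 0 ≤ Real.cos (w * t)}ᶜ) :=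
    eventually_measure_div_eight_le_inter hA.measurableSet hA.measure_ne_top (σ := -1) (by simp)
      (fun w => (hcl w).measurableSet.compl) fun w t ht => by
        simpa using ht
  obtain ⟨w, hw, hw'⟩ := (hpos.and hsmall).exists
  refine ⟨A ∩ {t : ℝ | 0 ≤ Real.cos (w * t)}, inter_subset_left, hA.inter_right (hcl w), ?_, hw⟩
  have hadd := measure_inter_add_sdiff (μ := volume) A (hcl w).measurableSet
  have hfin := hA.measure_ne_top (μ := volume)
  rw [sdiff_eq] at hadd
  have h1 : volume (A ∩ {t : ℝ | 0 ≤ Real.cos (w * t)}) ≠ ∞ :=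
    measure_ne_top_of_subset inter_subset_left hfin
  have h2 : volume (A ∩ {t : ℝ | 0 ≤ Real.cos (w * t)}ᶜ) ≠ ∞ :=
    measure_ne_top_of_subset inter_subset_left hfin
  rw [← ENNReal.toReal_le_toReal (by finiteness) h2, ENNReal.toReal_div] at hw'
  rw [← ENNReal.toReal_le_toReal h1 (by finiteness), ENNReal.toReal_mul, ENNReal.toReal_div]
  have hadd' := congrArg ENNReal.toReal hadd
  rw [ENNReal.toReal_add h1 h2] at hadd'
  norm_num at hw' ⊢
  linarith

/-- A compact set meeting `C - y` in positive measure for all `y` in a compact set `K` has a null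
subset meeting all these sets. -/
theorem exists_null_subset_forall_inter_nonempty {A C K : Set ℝ} (hA : IsCompact A)
    (hC : IsCompact C) (hK : IsCompact K) (h : ∀ y ∈ K, 0 < volume (A ∩ (· + y) ⁻¹' C)) :
    ∃ N ⊆ A, volume N = 0 ∧ ∀ y ∈ K, (N ∩ (· + y) ⁻¹' C).Nonempty := by
  let P : Set ℝ → Prop := fun S => IsCompact S ∧ ∀ y ∈ K, 0 < volume (S ∩ (· + y) ⁻¹' C)
  have step : ∀ S : {S // P S}, ∃ S' : {S // P S}, S'.1 ⊆ S.1 ∧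
      volume S'.1 ≤ (7 / 8) * volume S.1 := fun ⟨S, hS, hS'⟩ => by
    obtain ⟨T, hTS, hT, hvol, hT'⟩ :=
      exists_isCompact_subset_measure_le_forall_inter_pos hS hC hK hS'
    exact ⟨⟨T, hT, hT'⟩, hTS, hvol⟩
  choose next hsub hvol using step
  let u : ℕ → {S // P S} := fun n => next^[n] ⟨A, hA, h⟩
  have hu : ∀ n, u (n + 1) = next (u n) := fun n => Function.iterate_succ_apply' _ _ _
  have hanti : ∀ n, (u (n + 1)).1 ⊆ (u n).1 := fun n => hu n ▸ hsub (u n)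
  have hbound : ∀ n, volume (u n).1 ≤ (7 / 8) ^ n * volume A := by
    intro n
    induction n with
    | zero => simp [u]
    | succ n ih =>
      rw [hu, pow_succ', mul_assoc]
      exact (hvol _).trans (by gcongr)
  refine ⟨⋂ n, (u n).1, iInter_subset (fun n => (u n).1) 0, ?_, fun y hy => ?_⟩
  · have hlim : Tendsto (fun n : ℕ => (7 / 8 : ℝ≥0∞) ^ n * volume A) atTop (𝓝 (0 * volume A)) :=
      ENNReal.Tendsto.mul_const
        (ENNReal.tendsto_pow_atTop_nhds_zero_of_lt_one
          (ENNReal.div_lt_of_lt_mul (by norm_num)))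
        (Or.inr hA.measure_ne_top)
    rw [zero_mul] at hlim
    exact le_antisymm (ge_of_tendsto' hlim fun n =>
      (measure_mono (iInter_subset _ n)).trans (hbound n)) zero_le
  · have hcl : IsClosed ((· + y) ⁻¹' C) := hC.isClosed.preimage (by fun_prop)
    rw [iInter_inter]
    exact IsCompact.nonempty_iInter_of_sequence_nonempty_isCompact_isClosed _
      (fun n => inter_subset_inter_left _ (hanti n))
      (fun n => nonempty_of_measure_ne_zero ((u n).2.2 y hy).ne')
      ((u 0).2.1.inter_right hcl) fun n => (u n).2.1.isClosed.inter hcl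

theorem exists_null_subset_eventually_inter_nonempty {A C : Set ℝ} (hA : MeasurableSet A)
    (hC : MeasurableSet C) {x : ℝ} (h : 0 < volume (A ∩ (· + x) ⁻¹' C)) :
    ∃ N ⊆ A, volume N = 0 ∧ ∀ᶠ y in 𝓝 x, (N ∩ (· + y) ⁻¹' C).Nonempty := by
  obtain ⟨Q, hQ, hQc, hQpos⟩ :=
    (hA.inter (hC.preimage (measurable_add_const x))).exists_lt_isCompact h
  have hDc : IsCompact ((· + x) '' Q) := hQc.image (by fun_prop)
  have hDC : (· + x) '' Q ⊆ C := image_subset_iff.2 fun t ht => (hQ ht).2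
  have hself : Q ∩ (· + x) ⁻¹' ((· + x) '' Q) = Q := inter_eq_left.2 (subset_preimage_image _ _)
  have hev : ∀ᶠ y in 𝓝 x, 0 < volume (Q ∩ (· + y) ⁻¹' ((· + x) '' Q)) := by
    filter_upwards [(tendsto_measure_symmDiff_add_preimage hDc.measurableSet hDc.measure_ne_top
      x).eventually_lt_const hQpos] with y hy
    exact measure_inter_add_preimage_pos_of_symmDiff_lt (hy.trans_eq (congrArg volume hself.symm))
  obtain ⟨K, hK, hKsub, hKc⟩ := local_compact_nhds hev
  obtain ⟨N, hNQ, hN0, hN⟩ := exists_null_subset_forall_inter_nonempty hQc hDc hKc hKsub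
  refine ⟨N, hNQ.trans fun t ht => (hQ ht).1, hN0, ?_⟩
  filter_upwards [hK] with y hy
  exact (hN y hy).mono (inter_subset_inter_right _ (preimage_mono hDC))

theorem stmt_0 (A B : Set ℝ) (hA : MeasurableSet A) (hB : MeasurableSet B)
    (h : ∀ N, N ⊆ A → volume N = 0 → ∃ x : ℝ, (fun a => a + x) '' N ⊆ B) :
    ∃ N₀, N₀ ⊆ A ∧ volume N₀ = 0 ∧ ∃ x : ℝ, (fun a => a + x) '' (A \ N₀) ⊆ B := by
  by_contra! hcon
  have hpos : ∀ x : ℝ, 0 < volume (A ∩ (· + x) ⁻¹' Bᶜ) := by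
    intro x
    rw [pos_iff_ne_zero]
    intro h0
    refine hcon _ inter_subset_left h0 x ?_
    rintro _ ⟨t, ⟨htA, ht⟩, rfl⟩
    by_contra htB
    exact ht ⟨htA, htB⟩
  choose N hNA hN0 hN using fun x =>
    exists_null_subset_eventually_inter_nonempty hA hB.compl (hpos x)
  obtain ⟨s, hs, hcover⟩ := TopologicalSpace.countable_cover_nhds hN
  obtain ⟨y, hy⟩ := h (⋃ x ∈ s, N x) (iUnion₂_subset fun x _ => hNA x)
    ((measure_biUnion_null_iff hs).2 fun x _ => hN0 x)
  obtain ⟨x, hxs, t, htN, ht⟩ := mem_iUnion₂.1 (hcover.symm ▸ mem_univ y)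
  exact ht (hy ⟨t, mem_iUnion₂.2 ⟨x, hxs, htN⟩, rfl⟩)
end

section
/- Let A ⊆ ℝ be Lebesgue measurable, and let B ⊆ ℝ be d-closed (i.e., B contains every point x ∈ ℝ at which the upper density of B is positive) and a Gδ set in the Euclidean topology. If every Lebesgue null subset of A can be translated into B, then A can be translated into B; that is, there exists x ∈ ℝ with A + x ⊆ B. -/
open MeasureTheory Filter Set
open scoped Pointwise ENNReal Topology

/-- The upper density of a set `B ⊆ ℝ` at a point `x`:
`limsup_{h→0⁺} |B ∩ [x−h, x+h]| / (2h)`. -/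
noncomputable def upperDensity (B : Set ℝ) (x : ℝ) : ℝ≥0∞ :=
  Filter.limsup
    (fun h : ℝ => volume (B ∩ Set.Icc (x - h) (x + h)) / ENNReal.ofReal (2 * h))
    (𝓝[>] (0 : ℝ))

/-- Small translations move a compact set of reals by a set of small measure. -/
lemma IsCompact.eventually_measureReal_shift_diff_lt {K : Set ℝ} (hK : IsCompact K) {η : ℝ}
    (hη : 0 < η) :
    ∀ᶠ s in 𝓝[>] (0 : ℝ), volume.real ((fun y => y - s) ⁻¹' K \ K) < η := by
  have hlim := (ENNReal.tendsto_toReal hK.measure_lt_top.ne).comp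
    (tendsto_measure_cthickening_of_isCompact (μ := (volume : Measure ℝ)) hK)
  have hev : ∀ᶠ s in 𝓝 (0 : ℝ), volume.real (Metric.cthickening s K) < volume.real K + η :=
    hlim.eventually_lt_const (by simpa [Measure.real] using hη)
  filter_upwards [nhdsWithin_le_nhds hev, self_mem_nhdsWithin] with s hs hs0
  have hfin : volume (Metric.cthickening s K) ≠ ∞ := hK.isBounded.cthickening.measure_lt_top.ne
  have hsub : (fun y => y - s) ⁻¹' K \ K ⊆ Metric.cthickening s K \ K := by
    rintro y ⟨hy, hyK⟩
    refine ⟨Metric.mem_cthickening_of_dist_le y (y - s) s K hy ?_, hyK⟩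
    simp [abs_of_pos (mem_Ioi.1 hs0)]
  have h₁ := measureReal_mono (μ := volume) hsub (measure_ne_top_of_subset sdiff_subset hfin)
  have h₂ := measureReal_sdiff (μ := volume) (Metric.self_subset_cthickening (δ := s) K)
    hK.measurableSet hfin
  linarith

/-- The periodic set `{x | 0 ≤ sin (π x / s)}`, alternating intervals of length `s`. -/
def sineStripes (s : ℝ) : Set ℝ := {x | 0 ≤ Real.sin (Real.pi * x / s)}

lemma isClosed_sineStripes (s : ℝ) : IsClosed (sineStripes s) :=
  isClosed_le continuous_const (by fun_prop)

lemma sin_pi_mul_sub_div {s : ℝ} (hs : s ≠ 0) (y : ℝ) :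
    Real.sin (Real.pi * (y - s) / s) = -Real.sin (Real.pi * y / s) := by
  rw [← Real.sin_sub_pi]
  congr 1
  field_simp

lemma volume_zeros_sin_pi_mul_div {s : ℝ} (hs : s ≠ 0) :
    volume {x : ℝ | Real.sin (Real.pi * x / s) = 0} = 0 := by
  refine ((countable_range fun n : ℤ => n * s).mono ?_).measure_zero _
  intro x hx
  obtain ⟨n, hn⟩ := Real.sin_eq_zero_iff.1 hx
  refine ⟨n, ?_⟩
  field_simp at hn
  exact hn

lemma measureReal_shift (s : ℝ) (E : Set ℝ) :
    volume.real ((fun y => y - s) ⁻¹' E) = volume.real E := by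
  simp [Measure.real, sub_eq_add_neg, measure_preimage_add_right]

/-- Stripes of width `s` retain at least half of `G`, up to the shift error. -/
lemma measureReal_le_two_mul_inter_sineStripes {s : ℝ} (hs : s ≠ 0) {G : Set ℝ}
    (hG : IsCompact G) :
    volume.real G ≤ 2 * volume.real (G ∩ sineStripes s)
      + volume.real ((fun y => y - s) ⁻¹' G \ G) := by
  have hGs : volume ((fun y => y - s) ⁻¹' G) ≠ ∞ := by
    simpa [sub_eq_add_neg, measure_preimage_add_right] using hG.measure_lt_top.ne
  have hsplit := measureReal_inter_add_sdiff (μ := volume) (s := G)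
    (isClosed_sineStripes s).measurableSet hG.measure_lt_top.ne
  have hsub : (fun y => y - s) ⁻¹' (G \ sineStripes s) ⊆
      (G ∩ sineStripes s) ∪ ((fun y => y - s) ⁻¹' G \ G) := by
    rintro y ⟨hy, hyP⟩
    by_cases hyG : y ∈ G
    · refine Or.inl ⟨hyG, ?_⟩
      simp only [sineStripes, mem_ofPred_eq, not_le, sin_pi_mul_sub_div hs] at hyP ⊢
      linarith
    · exact Or.inr ⟨hy, hyG⟩
  have h₁ := measureReal_mono (μ := volume) hsub
    (measure_union_ne_top (measure_ne_top_of_subset inter_subset_left hG.measure_lt_top.ne)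
      (measure_ne_top_of_subset sdiff_subset hGs))
  have h₂ := measureReal_union_le (μ := volume) (G ∩ sineStripes s)
    ((fun y => y - s) ⁻¹' G \ G)
  rw [measureReal_shift] at h₁
  linarith

/-- Stripes of width `s` retain at most half of `G`, up to the shift error. -/
lemma two_mul_measureReal_inter_sineStripes_le {s : ℝ} (hs : s ≠ 0) {G : Set ℝ}
    (hG : IsCompact G) :
    2 * volume.real (G ∩ sineStripes s) ≤ volume.real G
      + volume.real ((fun y => y - s) ⁻¹' G \ G) := by
  have hGs : volume ((fun y => y - s) ⁻¹' G) ≠ ∞ := by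
    simpa [sub_eq_add_neg, measure_preimage_add_right] using hG.measure_lt_top.ne
  have hsplit := measureReal_inter_add_sdiff (μ := volume) (s := G)
    (isClosed_sineStripes s).measurableSet hG.measure_lt_top.ne
  have hsub : (fun y => y - s) ⁻¹' (G ∩ sineStripes s) ⊆
      ((G \ sineStripes s) ∪ ((fun y => y - s) ⁻¹' G \ G))
        ∪ {x : ℝ | Real.sin (Real.pi * x / s) = 0} := by
    rintro y ⟨hy, hyP⟩
    simp only [sineStripes, mem_ofPred_eq, sin_pi_mul_sub_div hs] at hyP
    by_cases hyG : y ∈ G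
    · by_cases hz : Real.sin (Real.pi * y / s) = 0
      · exact Or.inr hz
      · refine Or.inl (Or.inl ⟨hyG, fun hyS => hz ?_⟩)
        exact le_antisymm (by linarith) hyS
    · exact Or.inl (Or.inr ⟨hy, hyG⟩)
  have hz := volume_zeros_sin_pi_mul_div hs
  have h₁ := measureReal_mono (μ := volume) hsub
    (measure_union_ne_top
      (measure_union_ne_top (measure_ne_top_of_subset sdiff_subset hG.measure_lt_top.ne)
        (measure_ne_top_of_subset sdiff_subset hGs)) (by simp [hz]))
  have h₂ := measureReal_union_le (μ := volume) (G \ sineStripes s)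
    ((fun y => y - s) ⁻¹' G \ G)
  have h₃ := measureReal_union_le (μ := volume)
    ((G \ sineStripes s) ∪ ((fun y => y - s) ⁻¹' G \ G))
    {x : ℝ | Real.sin (Real.pi * x / s) = 0}
  have h₄ : volume.real {x : ℝ | Real.sin (Real.pi * x / s) = 0} = 0 := by
    simp [Measure.real, hz]
  rw [measureReal_shift] at h₁
  linarith

/-- A compact set can be shrunk by a definite factor while keeping a quarter of every large
intersection with a translate of a fixed compact set. -/
lemma IsCompact.exists_thinning {K F : Set ℝ} (hK : IsCompact K) (hF : IsCompact F) {c : ℝ}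
    (hc : 0 < c) :
    ∃ K' ⊆ K, IsCompact K' ∧ volume.real K' ≤ 3 / 4 * volume.real K ∧
      ∀ x, c ≤ volume.real (K ∩ (fun y => y + x) ⁻¹' F) →
        c / 4 ≤ volume.real (K' ∩ (fun y => y + x) ⁻¹' F) := by
  rcases (measureReal_nonneg : 0 ≤ volume.real K).eq_or_lt with h0 | h0
  · refine ⟨∅, empty_subset _, isCompact_empty, by simp [← h0], fun x hx => ?_⟩
    have := measureReal_mono (μ := volume)
      (inter_subset_left : K ∩ (fun y => y + x) ⁻¹' F ⊆ K) hK.measure_lt_top.ne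
    linarith
  obtain ⟨s, ⟨⟨hs₁, hs₂⟩, hs₃⟩, hs0⟩ :=
    (((hK.eventually_measureReal_shift_diff_lt (half_pos h0)).and
      (hK.eventually_measureReal_shift_diff_lt (by positivity : 0 < c / 4))).and
      (hF.eventually_measureReal_shift_diff_lt (by positivity : 0 < c / 4))
      |>.and self_mem_nhdsWithin).exists
  have hs : s ≠ 0 := (mem_Ioi.1 hs0).ne'
  refine ⟨K ∩ sineStripes s, inter_subset_left, hK.inter_right (isClosed_sineStripes s), ?_,
    fun x hx => ?_⟩
  · have := two_mul_measureReal_inter_sineStripes_le hs hK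
    linarith
  · have hG : IsCompact (K ∩ (fun y => y + x) ⁻¹' F) :=
      hK.inter_right (hF.isClosed.preimage (by fun_prop))
    have h₁ := measureReal_le_two_mul_inter_sineStripes hs hG
    have hsub : (fun y => y - s) ⁻¹' (K ∩ (fun y => y + x) ⁻¹' F) \
        (K ∩ (fun y => y + x) ⁻¹' F) ⊆ ((fun y => y - s) ⁻¹' K \ K) ∪
          (fun y => y - -x) ⁻¹' ((fun y => y - s) ⁻¹' F \ F) := by
      rintro y ⟨⟨hyK, hyF⟩, hy⟩
      by_cases hK' : y ∈ K
      · refine Or.inr ⟨?_, fun hF' => hy ⟨hK', ?_⟩⟩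
        · simp only [mem_preimage] at hyF ⊢
          convert hyF using 1
          ring
        · simpa using hF'
      · exact Or.inl ⟨hyK, hK'⟩
    have hfin : ∀ {E : Set ℝ} (t : ℝ), IsCompact E → volume ((fun y => y - t) ⁻¹' E) ≠ ∞ := by
      intro E t hE
      simpa [sub_eq_add_neg, measure_preimage_add_right] using hE.measure_lt_top.ne
    have hfin' : volume ((fun y => y - -x) ⁻¹' ((fun y => y - s) ⁻¹' F \ F)) ≠ ∞ := by
      have : volume ((fun y => y - s) ⁻¹' F \ F) ≠ ∞ :=
        measure_ne_top_of_subset sdiff_subset (hfin s hF)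
      simpa only [sub_neg_eq_add, measure_preimage_add_right] using this
    have h₂ := measureReal_mono (μ := volume) hsub
      (measure_union_ne_top (measure_ne_top_of_subset sdiff_subset (hfin s hK)) hfin')
    have h₃ := measureReal_union_le (μ := volume) ((fun y => y - s) ⁻¹' K \ K)
      ((fun y => y - -x) ⁻¹' ((fun y => y - s) ⁻¹' F \ F))
    rw [measureReal_shift] at h₃
    have h₄ : K ∩ (fun y => y + x) ⁻¹' F ∩ sineStripes s =
        K ∩ sineStripes s ∩ (fun y => y + x) ⁻¹' F := inter_right_comm _ _ _
    rw [h₄] at h₁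
    linarith

/-- A compact set contains a null set meeting every translate of `F` which meets the compact set
in measure at least `c`. -/
lemma IsCompact.exists_null_subset_meeting {K F : Set ℝ} (hK : IsCompact K) (hF : IsCompact F)
    {c : ℝ} (hc : 0 < c) :
    ∃ N ⊆ K, volume N = 0 ∧
      ∀ x, c ≤ volume.real (K ∩ (fun y => y + x) ⁻¹' F) →
        (N ∩ (fun y => y + x) ⁻¹' F).Nonempty := by
  choose! T hTsub hTcomp hTvol hTint using
    fun (L : Set ℝ) (d : ℝ) (hL : IsCompact L) (hd : 0 < d) => hL.exists_thinning hF hd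
  let L : ℕ → Set ℝ := fun n => n.rec K fun n E => T E (c / 4 ^ n)
  have hL0 : L 0 = K := rfl
  have hLs : ∀ n, L (n + 1) = T (L n) (c / 4 ^ n) := fun _ => rfl
  have hcn : ∀ n : ℕ, 0 < c / 4 ^ n := fun n => by positivity
  have hLc : ∀ n, IsCompact (L n) := by
    intro n
    induction n with
    | zero => exact hK
    | succ n ih => exact hLs n ▸ hTcomp _ _ ih (hcn n)
  have hLv : ∀ n, volume.real (L n) ≤ (3 / 4) ^ n * volume.real K := by
    intro n
    induction n with
    | zero => simp [hL0]
    | succ n ih =>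
      have := hTvol _ _ (hLc n) (hcn n)
      rw [hLs, pow_succ]
      linarith
  have hLi : ∀ x, c ≤ volume.real (K ∩ (fun y => y + x) ⁻¹' F) →
      ∀ n, c / 4 ^ n ≤ volume.real (L n ∩ (fun y => y + x) ⁻¹' F) := by
    intro x hx n
    induction n with
    | zero => simpa [hL0] using hx
    | succ n ih =>
      have := hTint _ _ (hLc n) (hcn n) x ih
      rwa [hLs, pow_succ, ← div_div]
  have hmono : ∀ n, L (n + 1) ⊆ L n := fun n => hLs n ▸ hTsub _ _ (hLc n) (hcn n)
  refine ⟨⋂ n, L n, iInter_subset _ 0, ?_, fun x hx => ?_⟩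
  · have hfin : volume (⋂ n, L n) ≠ ∞ :=
      measure_ne_top_of_subset (iInter_subset _ 0) (hLc 0).measure_lt_top.ne
    have hle : ∀ n : ℕ, volume.real (⋂ n, L n) ≤ (3 / 4) ^ n * volume.real K := fun n =>
      (measureReal_mono (iInter_subset _ n) (hLc n).measure_lt_top.ne).trans (hLv n)
    have hlim : Tendsto (fun n : ℕ => (3 / 4 : ℝ) ^ n * volume.real K) atTop (𝓝 0) := by
      simpa using (tendsto_pow_atTop_nhds_zero_of_lt_one (by norm_num : (0 : ℝ) ≤ 3 / 4)
        (by norm_num)).mul_const (volume.real K)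
    exact (measureReal_eq_zero_iff hfin).1
      (le_antisymm (ge_of_tendsto' hlim hle) measureReal_nonneg)
  · have hFx : IsClosed ((fun y => y + x) ⁻¹' F) := hF.isClosed.preimage (by fun_prop)
    rw [iInter_inter]
    refine IsCompact.nonempty_iInter_of_sequence_nonempty_isCompact_isClosed _
      (fun n => inter_subset_inter_left _ (hmono n)) (fun n => ?_)
      ((hLc 0).inter_right hFx) fun n => (hLc n).isClosed.inter hFx
    refine nonempty_of_measureReal_ne_zero (μ := volume) ?_
    exact ((hcn n).trans_le (hLi x hx n)).ne'

/-- A measurable set of reals is covered, up to a null set, by countably many compact subsets. -/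
lemma MeasurableSet.exists_compacts_ae_cover {A : Set ℝ} (hA : MeasurableSet A) :
    ∃ K : ℕ × ℕ → Set ℝ, (∀ i, IsCompact (K i)) ∧ (∀ i, K i ⊆ A) ∧
      volume (A \ ⋃ i, K i) = 0 := by
  have hfin : ∀ n : ℕ, volume (A ∩ Metric.closedBall 0 n) ≠ ∞ := fun n =>
    measure_ne_top_of_subset inter_subset_right measure_closedBall_lt_top.ne
  have hex : ∀ i : ℕ × ℕ, ∃ K ⊆ A ∩ Metric.closedBall 0 i.1, IsCompact K ∧
      volume ((A ∩ Metric.closedBall 0 i.1) \ K) < ((i.2 : ℝ≥0∞) + 1)⁻¹ := fun i =>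
    (hA.inter Metric.isClosed_closedBall.measurableSet).exists_isCompact_sdiff_lt (hfin i.1)
      (by simp)
  choose K hKsub hKc hKv using hex
  refine ⟨K, hKc, fun i => (hKsub i).trans inter_subset_left, ?_⟩
  have hcover : A \ ⋃ i, K i ⊆ ⋃ n : ℕ, (A ∩ Metric.closedBall 0 n) \ ⋃ i, K i := by
    rintro y ⟨hyA, hyK⟩
    obtain ⟨n, hn⟩ := exists_nat_ge (dist y 0)
    exact mem_iUnion.2 ⟨n, ⟨hyA, hn⟩, hyK⟩
  refine measure_mono_null hcover (measure_iUnion_null fun n => ?_)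
  refine le_antisymm (ge_of_tendsto' ENNReal.tendsto_inv_nat_nhds_zero fun k => ?_) zero_le
  refine (measure_mono (sdiff_subset_sdiff_right (subset_iUnion K (n, k)))).trans
    ((hKv (n, k)).le.trans ?_)
  exact ENNReal.inv_le_inv.2 le_self_add

/-- If `A + x` is almost contained in `B` then `B` has positive upper density at the translates of
density points of `A`. -/
lemma upperDensity_pos_of_translate_ae_subset {A B : Set ℝ} {a x : ℝ}
    (ha : Tendsto (fun r => volume (A ∩ Metric.closedBall a r) / volume (Metric.closedBall a r))
      (𝓝[>] 0) (𝓝 1))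
    (hnull : volume (A ∩ (fun y => y + x) ⁻¹' Bᶜ) = 0) :
    0 < upperDensity B (a + x) := by
  refine zero_lt_one.trans_le (ha.limsup_eq.symm.le.trans (limsup_le_limsup ?_))
  filter_upwards with r
  rw [Real.volume_closedBall]
  refine ENNReal.div_le_div_right ?_ _
  rw [← measure_preimage_add_right volume x (B ∩ _)]
  refine measure_mono_ae ?_
  filter_upwards [measure_eq_zero_iff_ae_notMem.1 hnull] with y hy hyA
  obtain ⟨hyA, hyr⟩ := hyA
  rw [Real.closedBall_eq_Icc] at hyr
  refine ⟨?_, ?_, ?_⟩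
  · by_contra hyB
    exact hy ⟨hyA, hyB⟩
  · linarith [hyr.1]
  · linarith [hyr.2]

theorem stmt_1 (A B : Set ℝ) (hA : MeasurableSet A)
    (hBclosed : ∀ x : ℝ, 0 < upperDensity B x → x ∈ B) (hBGδ : IsGδ B)
    (h : ∀ N, N ⊆ A → volume N = 0 → ∃ x : ℝ, (fun a => a + x) '' N ⊆ B) :
    ∃ x : ℝ, (fun a => a + x) '' A ⊆ B := by
  obtain ⟨U, hU, hBU⟩ := isGδ_iff_eq_iInter_nat.1 hBGδ
  obtain ⟨K, hKc, hKA, hKcov⟩ := hA.exists_compacts_ae_cover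
  let F : ℕ × ℕ → Set ℝ := fun j => (U j.1)ᶜ ∩ Metric.closedBall 0 j.2
  have hFc : ∀ j, IsCompact (F j) := fun j =>
    (isCompact_closedBall 0 _).inter_left (hU j.1).isClosed_compl
  have hFB : ∀ j, F j ⊆ Bᶜ := fun j y hy hyB => hy.1 (mem_iInter.1 (hBU ▸ hyB) j.1)
  have hFcov : Bᶜ ⊆ ⋃ j, F j := by
    intro y hy
    rw [hBU, compl_iInter] at hy
    obtain ⟨n, hn⟩ := mem_iUnion.1 hy
    obtain ⟨m, hm⟩ := exists_nat_ge (dist y 0)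
    exact mem_iUnion.2 ⟨(n, m), hn, hm⟩
  choose N hNK hN0 hNmeet using fun p : ((ℕ × ℕ) × (ℕ × ℕ)) × ℕ =>
    (hKc p.1.1).exists_null_subset_meeting (hFc p.1.2)
      (by positivity : (0 : ℝ) < 1 / ((p.2 : ℝ) + 1))
  let D : Set ℝ := {a | Tendsto
    (fun r => volume (A ∩ Metric.closedBall a r) / volume (Metric.closedBall a r))
      (𝓝[>] 0) (𝓝 1)}
  have hAD : volume (A \ D) = 0 := by
    refine measure_mono_null ?_
      (ae_iff.1 (Besicovitch.ae_tendsto_measure_inter_div_of_measurableSet volume hA))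
    rintro a ⟨haA, haD⟩ hlim
    rw [indicator_of_mem haA] at hlim
    exact haD hlim
  obtain ⟨x, hx⟩ := h ((A \ D) ∪ ⋃ p, N p)
    (union_subset sdiff_subset (iUnion_subset fun p => (hNK p).trans (hKA _)))
    (measure_union_null hAD (measure_iUnion_null hN0))
  refine ⟨x, ?_⟩
  rintro _ ⟨a, haA, rfl⟩
  by_cases haD : a ∈ D
  swap
  · exact hx ⟨a, Or.inl ⟨haA, haD⟩, rfl⟩
  refine hBclosed _ (upperDensity_pos_of_translate_ae_subset haD ?_)
  have hsub : A ∩ (fun y => y + x) ⁻¹' Bᶜ ⊆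
      (A \ ⋃ i, K i) ∪ ⋃ q : (ℕ × ℕ) × (ℕ × ℕ), K q.1 ∩ (fun y => y + x) ⁻¹' F q.2 := by
    rintro y ⟨hyA, hyB⟩
    by_cases hyK : y ∈ ⋃ i, K i
    · obtain ⟨i, hi⟩ := mem_iUnion.1 hyK
      obtain ⟨j, hj⟩ := mem_iUnion.1 (hFcov hyB)
      exact Or.inr (mem_iUnion.2 ⟨(i, j), hi, hj⟩)
    · exact Or.inl ⟨hyA, hyK⟩
  refine measure_mono_null hsub (measure_union_null hKcov (measure_iUnion_null fun q => ?_))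
  by_contra hpos
  have hfin : volume (K q.1 ∩ (fun y => y + x) ⁻¹' F q.2) ≠ ∞ :=
    measure_ne_top_of_subset inter_subset_left (hKc _).measure_lt_top.ne
  obtain ⟨k, hk⟩ := exists_nat_one_div_lt (ENNReal.toReal_pos hpos hfin)
  obtain ⟨y, hyN, hyF⟩ := hNmeet (q, k) x hk.le
  exact hFB _ hyF (hx ⟨y, Or.inr (mem_iUnion.2 ⟨_, hyN⟩), rfl⟩)
end

section
/- Suppose A ⊆ ℝ is Lebesgue measurable, B ⊆ ℝ is an Fσ set, and the upper density of B is positive at every point of B (d̄(B,x) > 0 for all x ∈ B). Then there exists a Lebesgue null set N ⊆ A such that N + B = A + B. -/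
open MeasureTheory Filter Set
open scoped Pointwise ENNReal Topology

/-- The Riemann–Lebesgue lemma for cosine integrals over a set of finite measure. -/
lemma tendsto_setIntegral_cos_atTop {E : Set ℝ} (hE : MeasurableSet E) (hfin : volume E ≠ ∞) :
    Tendsto (fun w : ℝ => ∫ x in E, Real.cos (2 * Real.pi * (x * w))) atTop (𝓝 0) := by
  have h := (Real.tendsto_integral_exp_smul_cocompact (E.indicator fun _ => (1 : ℂ))).mono_left
    atTop_le_cocompact
  have h' := (Complex.continuous_re.tendsto 0).comp h
  rw [Complex.zero_re] at h'
  refine h'.congr fun w => ?_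
  have hind : Integrable (E.indicator fun _ => (1 : ℂ)) :=
    (integrable_indicator_iff hE).2 (integrableOn_const hfin)
  have hint : Integrable fun v : ℝ =>
      Real.fourierChar (-(v * w)) • E.indicator (fun _ => (1 : ℂ)) v := by
    simpa [mul_comm] using (Real.fourierIntegral_convergent_iff w).2 hind
  have hre := integral_re hint
  simp only [RCLike.re_to_complex] at hre
  rw [Function.comp_apply, ← hre, ← integral_indicator hE]
  refine integral_congr_ae (Eventually.of_forall fun v => ?_)
  by_cases hv : v ∈ E
  · simp only [indicator_of_mem hv, Circle.smul_def, Real.fourierChar_apply, smul_eq_mul, mul_one]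
    rw [Complex.exp_ofReal_mul_I_re, ← Real.cos_neg]
    congr 1
    ring
  · simp [indicator_of_notMem hv]

/-- A set of positive finite measure meets the set where a rapidly oscillating cosine has a given
sign in a definite proportion of its measure. -/
lemma eventually_measureReal_inter_cos_pos {E : Set ℝ} (hE : MeasurableSet E)
    (hfin : volume E ≠ ∞) (hpos : 0 < volume E) {σ : ℝ} (hσ : |σ| = 1) :
    ∀ᶠ w : ℝ in atTop, volume.real E / 8 <
      volume.real (E ∩ {x | 0 < σ * Real.cos (2 * Real.pi * (x * w))}) := by
  have hpos' : 0 < volume.real E := ENNReal.toReal_pos hpos.ne' hfin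
  have h1 := tendsto_setIntegral_cos_atTop hE hfin
  have h2 := h1.comp (tendsto_id.const_mul_atTop (zero_lt_two' ℝ))
  have hlim := (h2.div_const 2).add (h1.const_mul σ)
  simp only [zero_div, mul_zero, add_zero] at hlim
  have hev := hlim.eventually (lt_mem_nhds (show -(volume.real E / 4) < 0 by linarith))
  filter_upwards [hev] with w hw
  set P : Set ℝ := {x | 0 < σ * Real.cos (2 * Real.pi * (x * w))}
  have hPm : MeasurableSet P :=
    (isOpen_lt continuous_const (by fun_prop)).measurableSet
  have : IsFiniteMeasure (volume.restrict E) := ⟨by simpa using hfin.lt_top⟩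
  have hcos : ∀ u : ℝ, Integrable (fun x => Real.cos (2 * Real.pi * (x * u)))
      (volume.restrict E) := fun u =>
    Integrable.of_bound (by fun_prop) 1 (Eventually.of_forall fun x => by
      simpa using Real.abs_cos_le_one _)
  have hsum : Integrable (fun x => Real.cos (2 * Real.pi * (x * (2 * w))) / 2 +
      σ * Real.cos (2 * Real.pi * (x * w))) (volume.restrict E) :=
    ((hcos _).div_const 2).add ((hcos _).const_mul σ)
  have hle : ∫ x in E, (1 / 2 + (Real.cos (2 * Real.pi * (x * (2 * w))) / 2 +
      σ * Real.cos (2 * Real.pi * (x * w)))) ≤ ∫ x in E, P.indicator (fun _ => (2 : ℝ)) x := by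
    refine integral_mono ((integrable_const _).add hsum) ((integrable_const _).indicator hPm) fun x => ?_
    have hdouble : Real.cos (2 * Real.pi * (x * (2 * w))) =
        2 * Real.cos (2 * Real.pi * (x * w)) ^ 2 - 1 := by
      rw [← Real.cos_two_mul]
      ring_nf
    have hb := Real.abs_cos_le_one (2 * Real.pi * (x * w))
    have hσ2 : σ ^ 2 = 1 := by rw [← sq_abs, hσ, one_pow]
    set c := Real.cos (2 * Real.pi * (x * w))
    have hσc : |σ * c| ≤ 1 := by rwa [abs_mul, hσ, one_mul]
    have hcc : c ^ 2 = (σ * c) ^ 2 := by rw [mul_pow, hσ2, one_mul]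
    obtain ⟨hl, hu⟩ := abs_le.1 hσc
    simp only [hdouble, hcc]
    by_cases hx : x ∈ P
    · rw [indicator_of_mem hx]
      nlinarith
    · rw [indicator_of_notMem hx]
      have : σ * c ≤ 0 := not_lt.1 hx
      nlinarith
  rw [integral_add (integrable_const _) hsum,
    integral_add ((hcos _).div_const 2) ((hcos _).const_mul σ),
    integral_div 2 fun x => Real.cos (2 * Real.pi * (x * (2 * w))), integral_const_mul,
    integral_indicator hPm, Measure.restrict_restrict hPm, setIntegral_const, setIntegral_const,
    inter_comm P E] at hle
  simp only [Function.comp_apply, id, smul_eq_mul] at hw hle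
  linarith

lemma tendsto_measure_symmDiff_reflect {F : Set ℝ} (hF : MeasurableSet F) (hfin : volume F ≠ ∞)
    (s₀ : ℝ) :
    Tendsto (fun s => volume (symmDiff ((fun x => s - x) ⁻¹' F) ((fun x => s₀ - x) ⁻¹' F)))
      (𝓝 s₀) (𝓝 0) := by
  let f : C(ℝ, C(ℝ, ℝ)) := ContinuousMap.curry ⟨fun p : ℝ × ℝ => p.1 - p.2, by fun_prop⟩
  exact tendsto_measure_symmDiff_preimage_nhds_zero (f := f) (g := f s₀) (f.continuous.tendsto s₀)
    (Eventually.of_forall fun s => Measure.measurePreserving_sub_left volume s)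
    (Measure.measurePreserving_sub_left volume s₀) hF.nullMeasurableSet hfin

/-- If the reflected translates of `F` by `s` and `s₀` are close in measure, positivity of the
measure of an intersection is transferred from `s₀` to `s`. -/
lemma measure_inter_pos_of_symmDiff_lt {E F G : Set ℝ}
    (h : volume (symmDiff F G) < volume (E ∩ G)) : 0 < volume (E ∩ F) := by
  by_contra h0
  have h0' : volume (E ∩ F) = 0 := by simpa using h0
  refine absurd h (not_lt.2 ?_)
  calc volume (E ∩ G) ≤ volume ((E ∩ F) ∪ symmDiff F G) := by
        refine measure_mono fun x hx => ?_
        by_cases hF : x ∈ F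
        · exact Or.inl ⟨hx.1, hF⟩
        · exact Or.inr (Or.inr ⟨hx.2, hF⟩)
    _ ≤ volume (E ∩ F) + volume (symmDiff F G) := measure_union_le _ _
    _ = volume (symmDiff F G) := by rw [h0', zero_add]

/-- A compact set can be shrunk by a fixed proportion while still meeting all members of a compact
family of reflected translates in positive measure. -/
lemma exists_isCompact_subset_measure_le {A F S : Set ℝ} (hA : IsCompact A) (hF : IsCompact F)
    (hS : IsCompact S) (h : ∀ s ∈ S, 0 < volume (A ∩ (fun x => s - x) ⁻¹' F)) :
    ∃ A' ⊆ A, IsCompact A' ∧ volume.real A' ≤ 7 / 8 * volume.real A ∧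
      ∀ s ∈ S, 0 < volume (A' ∩ (fun x => s - x) ⁻¹' F) := by
  rcases eq_or_ne (volume A) 0 with h0 | h0
  · exact ⟨A, Subset.rfl, hA, by simp [Measure.real, h0], h⟩
  let C : ℝ → Set ℝ := fun w => {x | 0 ≤ Real.cos (2 * Real.pi * (x * w))}
  have hC : ∀ w, IsClosed (C w) := fun w => isClosed_le continuous_const (by fun_prop)
  have hshrink : ∀ᶠ w : ℝ in atTop, volume.real (A ∩ C w) ≤ 7 / 8 * volume.real A := by
    filter_upwards [eventually_measureReal_inter_cos_pos hA.measurableSet hA.measure_lt_top.ne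
      (pos_iff_ne_zero.2 h0) (σ := -1) (by simp)] with w hw
    have hset : A ∩ {x | 0 < -1 * Real.cos (2 * Real.pi * (x * w))} = A \ C w := by
      ext x
      simp [C]
    rw [hset] at hw
    have := measureReal_inter_add_sdiff (μ := volume) (s := A) (hC w).measurableSet
      hA.measure_lt_top.ne
    linarith
  have hmeet : ∀ᶠ w : ℝ in atTop, ∀ s ∈ S,
      0 < volume ((A ∩ C w) ∩ (fun x => s - x) ⁻¹' F) := by
    refine hS.induction_on (p := fun K => ∀ᶠ w : ℝ in atTop, ∀ s ∈ K,
      0 < volume ((A ∩ C w) ∩ (fun x => s - x) ⁻¹' F)) (by simp)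
      (fun s t hst ht => ht.mono fun w hw s hs => hw s (hst hs))
      (fun s t hs ht => ?_) (fun s₀ hs₀ => ?_)
    · filter_upwards [hs, ht] with w h1 h2 x hx
      exact hx.elim (h1 x) (h2 x)
    · have hpos := h s₀ hs₀
      have hfin : volume (A ∩ (fun x => s₀ - x) ⁻¹' F) ≠ ∞ :=
        ((measure_mono inter_subset_left).trans_lt hA.measure_lt_top).ne
      have hm : MeasurableSet (A ∩ (fun x => s₀ - x) ⁻¹' F) :=
        hA.measurableSet.inter (hF.measurableSet.preimage (by fun_prop))
      have hpos' : 0 < volume.real (A ∩ (fun x => s₀ - x) ⁻¹' F) / 8 :=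
        div_pos (ENNReal.toReal_pos hpos.ne' hfin) (by norm_num)
      have hnear := (tendsto_measure_symmDiff_reflect hF.measurableSet
        hF.measure_lt_top.ne s₀).eventually (gt_mem_nhds (ENNReal.ofReal_pos.2 hpos'))
      refine ⟨_, mem_nhdsWithin_of_mem_nhds hnear, ?_⟩
      filter_upwards [eventually_measureReal_inter_cos_pos hm hfin hpos (σ := 1) (by simp)]
        with w hw s hs
      refine measure_inter_pos_of_symmDiff_lt (lt_of_lt_of_le hs ?_)
      refine ENNReal.ofReal_le_of_le_toReal (hw.le.trans ?_)
      refine measureReal_mono (fun x hx => ⟨⟨hx.1.1, ?_⟩, hx.1.2⟩)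
        ((measure_mono (inter_subset_left.trans inter_subset_left)).trans_lt hA.measure_lt_top).ne
      have : 0 < 1 * Real.cos (2 * Real.pi * (x * w)) := hx.2
      rw [one_mul] at this
      exact this.le
  obtain ⟨w, hw1, hw2⟩ := (hshrink.and hmeet).exists
  exact ⟨A ∩ C w, inter_subset_left, hA.inter_right (hC w), hw1, hw2⟩

/-- A compact set contains a null set meeting all members of a compact family of reflected
translates that meet it in positive measure. -/
lemma exists_null_subset_of_isCompact {A F S : Set ℝ} (hA : IsCompact A) (hF : IsCompact F)
    (hS : IsCompact S) (h : ∀ s ∈ S, 0 < volume (A ∩ (fun x => s - x) ⁻¹' F)) :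
    ∃ N ⊆ A, volume N = 0 ∧ ∀ s ∈ S, (N ∩ (fun x => s - x) ⁻¹' F).Nonempty := by
  let T := {K : Set ℝ // IsCompact K ∧ ∀ s ∈ S, 0 < volume (K ∩ (fun x => s - x) ⁻¹' F)}
  have hstep : ∀ K : T, ∃ K' : T, K'.1 ⊆ K.1 ∧ volume.real K'.1 ≤ 7 / 8 * volume.real K.1 := by
    rintro ⟨K, hK, hKS⟩
    obtain ⟨K', hsub, hK', hle, hpos⟩ := exists_isCompact_subset_measure_le hK hF hS hKS
    exact ⟨⟨K', hK', hpos⟩, hsub, hle⟩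
  choose g hg using hstep
  let a : ℕ → T := fun n => g^[n] ⟨A, hA, h⟩
  have ha : ∀ n, a (n + 1) = g (a n) := fun n => Function.iterate_succ_apply' g n _
  have hsub : ∀ n, (a (n + 1)).1 ⊆ (a n).1 := fun n => by rw [ha]; exact (hg _).1
  have hmeas : ∀ n, volume.real (a n).1 ≤ (7 / 8) ^ n * volume.real A := by
    intro n
    induction n with
    | zero => simp [a]
    | succ n ih =>
      rw [ha, pow_succ]
      linarith [(hg (a n)).2]
  refine ⟨⋂ n, (a n).1, iInter_subset _ 0, ?_, fun s hs => ?_⟩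
  · have hfin : volume (⋂ n, (a n).1) ≠ ∞ :=
      ((measure_mono (iInter_subset _ 0)).trans_lt hA.measure_lt_top).ne
    have hle : ∀ n, volume.real (⋂ n, (a n).1) ≤ (7 / 8) ^ n * volume.real A := fun n =>
      (measureReal_mono (iInter_subset _ n) (a n).2.1.measure_lt_top.ne).trans (hmeas n)
    have hlim : Tendsto (fun n : ℕ => (7 / 8 : ℝ) ^ n * volume.real A) atTop (𝓝 0) := by
      simpa using (tendsto_pow_atTop_nhds_zero_of_lt_one (r := (7 / 8 : ℝ)) (by norm_num)
        (by norm_num)).mul_const (volume.real A)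
    exact (measureReal_eq_zero_iff hfin).1 (le_antisymm (ge_of_tendsto' hlim hle) measureReal_nonneg)
  · have hcl : IsClosed ((fun x => s - x) ⁻¹' F) := hF.isClosed.preimage (by fun_prop)
    rw [iInter_inter]
    refine IsCompact.nonempty_iInter_of_sequence_nonempty_isCompact_isClosed _
      (fun n => inter_subset_inter_left _ (hsub n))
      (fun n => nonempty_of_measure_ne_zero ((a n).2.2 s hs).ne')
      ((a 0).2.1.inter_right hcl) fun n => (a n).2.1.isClosed.inter hcl

/-- A compact set contains a null set meeting all reflected translates of a compact set that meet
it in positive measure. -/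
lemma exists_null_subset_inter_reflect_nonempty {A F : Set ℝ} (hA : IsCompact A)
    (hF : IsCompact F) :
    ∃ N ⊆ A, volume N = 0 ∧ ∀ s, 0 < volume (A ∩ (fun x => s - x) ⁻¹' F) →
      (N ∩ (fun x => s - x) ⁻¹' F).Nonempty := by
  have hopen : IsOpen {s | 0 < volume (A ∩ (fun x => s - x) ⁻¹' F)} := by
    rw [isOpen_iff_mem_nhds]
    intro s₀ hs₀
    filter_upwards [(tendsto_measure_symmDiff_reflect hF.measurableSet hF.measure_lt_top.ne
      s₀).eventually (gt_mem_nhds hs₀)] with s hs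
    exact measure_inter_pos_of_symmDiff_lt hs
  obtain ⟨C, hC, hCU, hUC, -⟩ := hopen.exists_iUnion_isClosed
  have hN : ∀ p : ℕ × ℕ, ∃ N ⊆ A, volume N = 0 ∧
      ∀ s ∈ C p.1 ∩ Icc (-(p.2 : ℝ)) p.2, (N ∩ (fun x => s - x) ⁻¹' F).Nonempty := fun p =>
    exists_null_subset_of_isCompact hA hF (isCompact_Icc.inter_left (hC p.1))
      fun s hs => hCU p.1 hs.1
  choose N hNA hN0 hNs using hN
  refine ⟨⋃ p, N p, iUnion_subset hNA, measure_iUnion_null hN0, fun s hs => ?_⟩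
  have hs' : s ∈ ⋃ n, C n := hUC ▸ hs
  obtain ⟨n, hn⟩ := mem_iUnion.1 hs'
  obtain ⟨m, hm⟩ := exists_nat_ge |s|
  exact (hNs (n, m) s ⟨hn, abs_le.1 hm⟩).mono (inter_subset_inter_left _ (subset_iUnion N _))

/-- A measurable set of reals is covered, up to a null set, by countably many compact subsets. -/
lemma exists_isCompact_measure_sdiff_iUnion_eq_zero {A : Set ℝ} (hA : MeasurableSet A) :
    ∃ K : ℕ × ℕ → Set ℝ, (∀ p, IsCompact (K p) ∧ K p ⊆ A) ∧ volume (A \ ⋃ p, K p) = 0 := by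
  have hfin : ∀ m : ℕ, volume (A ∩ Icc (-(m : ℝ)) m) ≠ ∞ := fun m =>
    ((measure_mono inter_subset_right).trans_lt isCompact_Icc.measure_lt_top).ne
  have hK : ∀ p : ℕ × ℕ, ∃ K ⊆ A ∩ Icc (-(p.1 : ℝ)) p.1, IsCompact K ∧
      volume ((A ∩ Icc (-(p.1 : ℝ)) p.1) \ K) < ((p.2 : ℝ≥0∞) + 1)⁻¹ := fun p =>
    (hA.inter measurableSet_Icc).exists_isCompact_sdiff_lt (hfin p.1) (by simp)
  choose K hKA hKc hKlt using hK
  refine ⟨K, fun p => ⟨hKc p, (hKA p).trans inter_subset_left⟩, ?_⟩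
  have hsub : A \ ⋃ p, K p ⊆ ⋃ m : ℕ, (A ∩ Icc (-(m : ℝ)) m) \ ⋃ p, K p := by
    intro x hx
    obtain ⟨m, hm⟩ := exists_nat_ge |x|
    exact mem_iUnion.2 ⟨m, ⟨hx.1, abs_le.1 hm⟩, hx.2⟩
  refine measure_mono_null hsub (measure_iUnion_null fun m => ?_)
  by_contra hne
  obtain ⟨k, hk⟩ := ENNReal.exists_inv_nat_lt hne
  refine absurd hk (not_lt.2 ?_)
  calc volume ((A ∩ Icc (-(m : ℝ)) m) \ ⋃ p, K p)
      ≤ volume ((A ∩ Icc (-(m : ℝ)) m) \ K (m, k)) :=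
        measure_mono (sdiff_subset_sdiff_right (subset_iUnion K (m, k)))
    _ ≤ ((k : ℝ≥0∞) + 1)⁻¹ := (hKlt (m, k)).le
    _ ≤ (k : ℝ≥0∞)⁻¹ := ENNReal.inv_le_inv.2 le_self_add

/-- If the complement of `A` has density zero at `a` and `B` has positive upper density at `b`,
then `A` meets the reflection of `B` exchanging `a` and `b` in positive measure. -/
lemma measure_inter_reflect_pos {A B : Set ℝ} {a b : ℝ}
    (ha : Tendsto (fun h => volume (Aᶜ ∩ Metric.closedBall a h) / volume (Metric.closedBall a h))
      (𝓝[>] 0) (𝓝 0))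
    (hb : 0 < upperDensity B b) : 0 < volume (A ∩ (fun x => a + b - x) ⁻¹' B) := by
  by_contra h0
  have h0' : volume (A ∩ (fun x => a + b - x) ⁻¹' B) = 0 := by simpa using h0
  obtain ⟨c, hc0, hc⟩ := exists_between hb
  obtain ⟨h, hBc, hAc⟩ := ((frequently_lt_of_lt_limsup (by isBoundedDefault) hc).and_eventually
    (ha.eventually (gt_mem_nhds hc0))).exists
  rw [Real.volume_closedBall] at hAc
  refine absurd (hAc.trans hBc) (not_lt.2 (ENNReal.div_le_div_right ?_ _))
  have hpre : (fun x => a + b - x) ⁻¹' (B ∩ Icc (b - h) (b + h)) =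
      (fun x => a + b - x) ⁻¹' B ∩ Metric.closedBall a h := by
    ext x
    simp only [mem_preimage, mem_inter_iff, mem_Icc, Real.closedBall_eq_Icc]
    constructor <;> rintro ⟨h1, h2, h3⟩ <;> exact ⟨h1, by linarith, by linarith⟩
  calc volume (B ∩ Icc (b - h) (b + h))
      = volume ((fun x => a + b - x) ⁻¹' B ∩ Metric.closedBall a h) := by
        rw [← hpre]
        exact ((Measure.measurePreserving_sub_left volume (a + b)).measure_preimage_equiv
          (f := MeasurableEquiv.subLeft (a + b)) _).symm
    _ ≤ volume ((A ∩ (fun x => a + b - x) ⁻¹' B) ∪ (Aᶜ ∩ Metric.closedBall a h)) := by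
        refine measure_mono fun x hx => ?_
        by_cases hxA : x ∈ A
        · exact Or.inl ⟨hxA, hx.1⟩
        · exact Or.inr ⟨hxA, hx.2⟩
    _ ≤ volume (A ∩ (fun x => a + b - x) ⁻¹' B) + volume (Aᶜ ∩ Metric.closedBall a h) :=
        measure_union_le _ _
    _ = volume (Aᶜ ∩ Metric.closedBall a h) := by rw [h0', zero_add]

theorem stmt_3 (A B : Set ℝ) (hA : MeasurableSet A)
    (hBFσ : ∃ f : ℕ → Set ℝ, (∀ n, IsClosed (f n)) ∧ B = ⋃ n, f n)
    (hB : ∀ x ∈ B, 0 < upperDensity B x) :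
    ∃ N, N ⊆ A ∧ volume N = 0 ∧ N + B = A + B := by
  obtain ⟨f, hf, rfl⟩ := hBFσ
  obtain ⟨K, hK, hAK⟩ := exists_isCompact_measure_sdiff_iUnion_eq_zero hA
  let F : ℕ × ℕ → Set ℝ := fun q => f q.1 ∩ Icc (-(q.2 : ℝ)) q.2
  have hF : ∀ q, IsCompact (F q) := fun q => isCompact_Icc.inter_left (hf q.1)
  have hFf : ⋃ n, f n ⊆ ⋃ q, F q := by
    intro x hx
    obtain ⟨n, hn⟩ := mem_iUnion.1 hx
    obtain ⟨m, hm⟩ := exists_nat_ge |x|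
    exact mem_iUnion.2 ⟨(n, m), hn, abs_le.1 hm⟩
  choose N hNK hN0 hN using fun r : (ℕ × ℕ) × (ℕ × ℕ) =>
    exists_null_subset_inter_reflect_nonempty (hK r.1).1 (hF r.2)
  let D : Set ℝ := {x | Tendsto
    (fun h => volume (Aᶜ ∩ Metric.closedBall x h) / volume (Metric.closedBall x h))
    (𝓝[>] 0) (𝓝 (Aᶜ.indicator 1 x))}
  have hD : volume Dᶜ = 0 := by
    have := Besicovitch.ae_tendsto_measure_inter_div_of_measurableSet (volume : Measure ℝ) hA.compl
    exact this
  refine ⟨(A ∩ Dᶜ) ∪ ⋃ r, N r, union_subset inter_subset_left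
    (iUnion_subset fun r => (hNK r).trans (hK r.1).2),
    measure_union_null (measure_mono_null inter_subset_right hD) (measure_iUnion_null hN0),
    Subset.antisymm (add_subset_add_right (union_subset inter_subset_left
      (iUnion_subset fun r => (hNK r).trans (hK r.1).2))) ?_⟩
  rintro _ ⟨a, ha, b, hb, rfl⟩
  by_cases haD : a ∈ D
  swap
  · exact add_mem_add (Or.inl ⟨ha, haD⟩) hb
  have hpos : 0 < volume (A ∩ (fun x => a + b - x) ⁻¹' ⋃ n, f n) := by
    refine measure_inter_reflect_pos ?_ (hB b hb)
    simpa [D, ha] using haD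
  have hex : ∃ r : (ℕ × ℕ) × (ℕ × ℕ), volume (K r.1 ∩ (fun x => a + b - x) ⁻¹' F r.2) ≠ 0 := by
    by_contra! hall
    refine hpos.ne' (measure_mono_null ?_ (measure_union_null hAK (measure_iUnion_null hall)))
    rintro x ⟨hxA, hxB⟩
    by_cases hxK : x ∈ ⋃ p, K p
    · obtain ⟨p, hp⟩ := mem_iUnion.1 hxK
      obtain ⟨q, hq⟩ := mem_iUnion.1 (hFf hxB)
      exact Or.inr (mem_iUnion.2 ⟨(p, q), hp, hq⟩)
    · exact Or.inl ⟨hxA, hxK⟩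
  obtain ⟨r, hr⟩ := hex
  obtain ⟨x, hxN, hxF⟩ := hN r (a + b) (pos_iff_ne_zero.2 hr)
  exact ⟨x, Or.inr (mem_iUnion.2 ⟨r, hxN⟩), a + b - x, mem_iUnion.2 ⟨r.2.1, hxF.1⟩,
    add_sub_cancel x (a + b)⟩
end

section
/- Let A and B be compact subsets of ℝ such that the upper density of B is positive at every point of B (d̄(B,x) > 0 for all x ∈ B). Then there exists a closed Lebesgue null set N ⊆ A such that N + B = A + B. -/
open MeasureTheory Filter Set
open scoped Pointwise ENNReal Topology

/-- A closed subset of a compact set `A` that is minimal among those whose sum with `B` still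
covers `A + B`. -/
lemma exists_minimal_isClosed_add_subset {A B : Set ℝ} (hA : IsCompact A) (hB : IsCompact B) :
    ∃ N, Minimal (· ∈ {N : Set ℝ | N ⊆ A ∧ IsClosed N ∧ A + B ⊆ N + B}) N := by
  refine zorn_superset _ fun c hc hchain => ?_
  rcases c.eq_empty_or_nonempty with rfl | hne
  · exact ⟨A, ⟨Subset.rfl, hA.isClosed, Subset.rfl⟩, by simp⟩
  refine ⟨⋂₀ c, ⟨?_, isClosed_sInter fun s hs => (hc hs).2.1, ?_⟩,
    fun s hs => sInter_subset_of_mem hs⟩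
  · obtain ⟨s, hs⟩ := hne
    exact (sInter_subset_of_mem hs).trans (hc hs).1
  intro z hz
  have hcl : IsClosed {x : ℝ | z - x ∈ B} := hB.isClosed.preimage (by fun_prop)
  have : Nonempty c := hne.to_subtype
  obtain ⟨x, hx⟩ := IsCompact.nonempty_iInter_of_directed_nonempty_isCompact_isClosed
    (fun s : c => (s : Set ℝ) ∩ {x : ℝ | z - x ∈ B})
    (by
      intro s t
      rcases hchain.total s.2 t.2 with h | h
      · exact ⟨s, Subset.rfl, inter_subset_inter_left _ h⟩
      · exact ⟨t, inter_subset_inter_left _ h, Subset.rfl⟩)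
    (by
      intro s
      obtain ⟨x, hx, y, hy, rfl⟩ := (hc s.2).2.2 hz
      exact ⟨x, hx, by simpa using hy⟩)
    (fun s => (hA.of_isClosed_subset (hc s.2).2.1 (hc s.2).1).inter_right hcl)
    (fun s => (hc s.2).2.1.inter hcl)
  rw [mem_iInter] at hx
  exact ⟨x, mem_sInter.2 fun s hs => (hx ⟨s, hs⟩).1, z - x, (hx hne.to_subtype.some).2, by simp⟩

/-- If `N` fills most of `[a - h, a + h]`, `B` has a definite part of `[b - h, b + h]`, and `z` is
close to `a + b`, then `N ∩ (z - B)` is not contained in a very short interval around `a`. -/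
lemma measureReal_inter_Icc_le_of_inter_subset_ball {N B : Set ℝ} {a b z h η δ : ℝ} (hh : 0 ≤ h)
    (hη : 0 ≤ η) (hδ : 0 ≤ δ) (hN : MeasurableSet N) (hz : |z - (a + b)| ≤ η)
    (hsub : ∀ x ∈ N, z - x ∈ B → x ∈ Metric.ball a δ) :
    volume.real (B ∩ Icc (b - h) (b + h)) ≤
      2 * δ + (2 * h - volume.real (N ∩ Icc (a - h) (a + h))) + 2 * η := by
  set E := B ∩ Icc (b - h) (b + h)
  have hT : (fun x => z - x) ⁻¹' E ⊆ Metric.ball a δ ∪ (Icc (a - h) (a + h) \ N) ∪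
      (Icc (a - h - η) (a - h) ∪ Icc (a + h) (a + h + η)) := by
    rintro x ⟨hxB, hx1, hx2⟩
    rw [abs_le] at hz
    by_cases hxN : x ∈ N
    · exact Or.inl (Or.inl (hsub x hxN hxB))
    rcases le_or_gt x (a - h) with h1 | h1
    · exact Or.inr (Or.inl ⟨by linarith, h1⟩)
    rcases le_or_gt x (a + h) with h2 | h2
    · exact Or.inl (Or.inr ⟨⟨h1.le, h2⟩, hxN⟩)
    · exact Or.inr (Or.inr ⟨h2.le, by linarith⟩)
  have hE : volume.real ((fun x => z - x) ⁻¹' E) = volume.real E := by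
    simp only [measureReal_def]
    congr 1
    exact (Measure.measurePreserving_sub_left volume z).measure_preimage_equiv
      (f := MeasurableEquiv.subLeft z) E
  have hfin : ∀ s t : ℝ, volume (Icc s t) ≠ ∞ := fun s t => by simp
  have hdiff : volume.real (Icc (a - h) (a + h) \ N) =
      2 * h - volume.real (N ∩ Icc (a - h) (a + h)) := by
    have := measureReal_inter_add_sdiff (μ := volume) (s := Icc (a - h) (a + h)) hN (hfin _ _)
    rw [Real.volume_real_Icc_of_le (by linarith), inter_comm] at this
    linarith
  have hb : volume.real (Metric.ball a δ) = 2 * δ := by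
    rw [Real.ball_eq_Ioo, Real.volume_real_Ioo_of_le (by linarith)]; ring
  calc volume.real E = volume.real ((fun x => z - x) ⁻¹' E) := hE.symm
    _ ≤ _ := measureReal_mono hT (by
        refine (measure_union_lt_top (measure_union_lt_top ?_ ?_) (measure_union_lt_top ?_ ?_)).ne
        · exact measure_ball_lt_top
        · exact (measure_mono sdiff_subset).trans_lt (hfin _ _).lt_top
        · exact (hfin _ _).lt_top
        · exact (hfin _ _).lt_top)
    _ ≤ _ := (measureReal_union_le _ _).trans
        (add_le_add (measureReal_union_le _ _) (measureReal_union_le _ _))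
    _ = _ := by
        rw [hdiff, hb, Real.volume_real_Icc_of_le (by linarith),
          Real.volume_real_Icc_of_le (by linarith)]
        ring

/-- At a point of positive upper density, `B` fills a fixed proportion of arbitrarily short
intervals. -/
lemma exists_frequently_lt_measureReal_of_upperDensity_pos {B : Set ℝ} {b : ℝ}
    (hb : 0 < upperDensity B b) :
    ∃ c : ℝ, 0 < c ∧
      ∃ᶠ h in 𝓝[>] (0 : ℝ), c * (2 * h) < volume.real (B ∩ Icc (b - h) (b + h)) := by
  obtain ⟨c, hc0, hc⟩ := ENNReal.lt_iff_exists_nnreal_btwn.1 hb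
  refine ⟨c, by exact_mod_cast hc0, ?_⟩
  refine ((frequently_lt_of_lt_limsup (by isBoundedDefault) hc).and_eventually
    self_mem_nhdsWithin).mono ?_
  rintro h ⟨h1, h0 : 0 < h⟩
  rw [ENNReal.lt_div_iff_mul_lt (Or.inl (by simpa using h0)) (Or.inl ENNReal.ofReal_ne_top)] at h1
  have hfin : volume (B ∩ Icc (b - h) (b + h)) ≠ ∞ :=
    ((measure_mono inter_subset_right).trans_lt (by simp)).ne
  have := (ENNReal.toReal_lt_toReal (by finiteness) hfin).2 h1
  rwa [ENNReal.toReal_mul, ENNReal.toReal_ofReal (by positivity), ENNReal.coe_toReal] at this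

/-- A set of positive measure fills almost all of every short interval around one of its points. -/
lemma exists_mem_eventually_lt_measureReal {N : Set ℝ} (hN : MeasurableSet N)
    (h0 : volume N ≠ 0) :
    ∃ a ∈ N, ∀ ε > 0, ∀ᶠ h in 𝓝[>] (0 : ℝ),
      (1 - ε) * (2 * h) < volume.real (N ∩ Icc (a - h) (a + h)) := by
  obtain ⟨a, haN, ha⟩ : ∃ a ∈ N, Tendsto
      (fun r => volume (N ∩ Metric.closedBall a r) / volume (Metric.closedBall a r))
      (𝓝[>] 0) (𝓝 1) := by
    by_contra! H
    refine h0 (measure_mono_null (fun x hx => ?_)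
      (ae_iff.1 (Besicovitch.ae_tendsto_measure_inter_div_of_measurableSet volume hN)))
    simpa [indicator_of_mem hx] using H x hx
  refine ⟨a, haN, fun ε hε => ?_⟩
  have ha' := (ENNReal.tendsto_toReal ENNReal.one_ne_top).comp ha
  filter_upwards [ha'.eventually (lt_mem_nhds (show 1 - ε < (1 : ℝ≥0∞).toReal by simpa using hε)),
    self_mem_nhdsWithin] with h h1 (hpos : 0 < h)
  rw [Function.comp_apply, ENNReal.toReal_div, Real.volume_closedBall,
    ENNReal.toReal_ofReal (by positivity), lt_div_iff₀ (by positivity), Real.closedBall_eq_Icc] at h1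
  exact h1

theorem stmt_4 (A B : Set ℝ) (hA : IsCompact A) (hBc : IsCompact B)
    (hB : ∀ x ∈ B, 0 < upperDensity B x) :
    ∃ N, N ⊆ A ∧ IsClosed N ∧ volume N = 0 ∧ N + B = A + B := by
  obtain ⟨N, ⟨hNA, hNc, hNB⟩, hmin⟩ := exists_minimal_isClosed_add_subset hA hBc
  refine ⟨N, hNA, hNc, ?_, (add_subset_add_right hNA).antisymm hNB⟩
  by_contra h0
  obtain ⟨a, haN, ha⟩ := exists_mem_eventually_lt_measureReal hNc.measurableSet h0
  have key : ∀ n : ℕ, ∃ x ∈ Metric.ball a (1 / ((n : ℝ) + 1)), ∃ y ∈ B,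
      ∀ x' ∈ N, x + y - x' ∈ B → x' ∈ Metric.ball a (1 / ((n : ℝ) + 1)) := by
    intro n
    by_contra! H
    refine (hmin (y := N \ Metric.ball a (1 / ((n : ℝ) + 1)))
      ⟨sdiff_subset.trans hNA, hNc.sdiff Metric.isOpen_ball, fun z hz => ?_⟩ sdiff_subset haN).2
      (Metric.mem_ball_self (by positivity))
    obtain ⟨x, hx, y, hy, rfl⟩ := hNB hz
    by_cases hxb : x ∈ Metric.ball a (1 / ((n : ℝ) + 1))
    · obtain ⟨x', hx', hx'B, hx'b⟩ := H x hxb y hy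
      exact ⟨x', ⟨hx', hx'b⟩, x + y - x', hx'B, by simp⟩
    · exact ⟨x, ⟨hx, hxb⟩, y, hy, rfl⟩
  choose x hx y hy hxy using key
  obtain ⟨b, hbB, φ, hφ, hlim⟩ := hBc.tendsto_subseq hy
  have hδ : Tendsto (fun n => 1 / ((φ n : ℝ) + 1)) atTop (𝓝 0) :=
    tendsto_one_div_add_atTop_nhds_zero_nat.comp hφ.tendsto_atTop
  obtain ⟨c, hc, hcB⟩ := exists_frequently_lt_measureReal_of_upperDensity_pos (hB b hbB)
  obtain ⟨h, ⟨hh1, hh2⟩, hpos : 0 < h⟩ :=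
    ((hcB.and_eventually (ha (c / 4) (by positivity))).and_eventually self_mem_nhdsWithin).exists
  have hch : 0 < c * h / 8 := by positivity
  obtain ⟨n, hn1, hn2⟩ := ((hδ.eventually (gt_mem_nhds hch)).and
    (hlim.eventually (Metric.ball_mem_nhds b hch))).exists
  have hxn := hx (φ n)
  rw [Metric.mem_ball, Real.dist_eq] at hxn
  rw [Function.comp_apply, Real.dist_eq] at hn2
  have hz : |x (φ n) + y (φ n) - (a + b)| ≤ c * h / 4 := by
    rw [add_sub_add_comm]
    exact (abs_add_le _ _).trans (by linarith)
  have := measureReal_inter_Icc_le_of_inter_subset_ball hpos.le (by positivity) (by positivity)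
    hNc.measurableSet hz (hxy (φ n))
  nlinarith
end

section
/- If A ⊆ ℝ is Lebesgue measurable with 0 < |A| < ∞, then for every ε > 0 there exists a compact set P ⊆ A such that |A \ P| < ε and the upper density of P at x is at least 1/2 for every x ∈ P (d̄(P,x) ≥ 1/2 for all x ∈ P). -/
open MeasureTheory Filter Set
open scoped Pointwise ENNReal Topology

/-- A compact set loses little measure when it is restricted to the cells of a fine grid that it
almost fills. -/
theorem exists_grid_volume_diff_le {K : Set ℝ} (hK : IsCompact K) {t : ℝ≥0∞} (ht : t ≠ 0) {η : ℝ}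
    (hη : 0 < η) :
    ∃ r : ℝ, 0 < r ∧ r < η ∧
      volume (K \ ⋃ k ∈ {k : ℤ | volume (Ico (k • r) ((k + 1) • r) \ K) ≤ ENNReal.ofReal (η * r)},
        Icc (k • r) ((k + 1) • r)) ≤ t := by
  have hlt : volume K < volume K + ENNReal.ofReal η * t :=
    ENNReal.lt_add_right hK.measure_lt_top.ne (by simp [ht, hη])
  have hev := ((tendsto_measure_cthickening_of_isCompact (μ := volume) hK).mono_left
    (nhdsWithin_le_nhds (s := Ioi 0))).eventually (gt_mem_nhds hlt)
  obtain ⟨r, hr, hr0, hrη⟩ := (hev.and (Ioo_mem_nhdsGT hη)).exists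
  refine ⟨r, hr0, hrη, ?_⟩
  set I : ℤ → Set ℝ := fun k => Ico (k • r) ((k + 1) • r)
  set B : Set ℤ := {k | ENNReal.ofReal (η * r) < volume (I k \ K) ∧ (I k ∩ K).Nonempty}
  have hvol : ∀ k, volume (I k) = ENNReal.ofReal r := fun k => by
    simp only [I, Real.volume_Ico]; congr 1; simp only [zsmul_eq_mul]; push_cast; ring
  have hcover : K \ (⋃ k ∈ {k : ℤ | volume (I k \ K) ≤ ENNReal.ofReal (η * r)},
      Icc (k • r) ((k + 1) • r)) ⊆ ⋃ k ∈ B, I k := by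
    rintro x ⟨hxK, hx⟩
    obtain ⟨k, hk, -⟩ := existsUnique_add_zsmul_mem_Ico hr0 x 0
    have hxk : x ∈ I (-k) := by
      simp only [I, mem_Ico, zsmul_eq_mul, zero_add] at hk ⊢
      push_cast
      constructor <;> nlinarith [hk.1, hk.2]
    refine mem_biUnion (x := -k) ⟨?_, x, hxk, hxK⟩ hxk
    by_contra! hgood
    exact hx (mem_biUnion (x := -k) hgood (Ico_subset_Icc_self hxk))
  have hthick : (⋃ k ∈ B, I k \ K) ⊆ Metric.cthickening r K \ K := by
    simp only [iUnion_subset_iff]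
    rintro k ⟨-, y, hyI, hyK⟩ x ⟨hxI, hxK⟩
    refine ⟨Metric.mem_cthickening_of_dist_le x y r K hyK ?_, hxK⟩
    simp only [I, mem_Ico, zsmul_eq_mul] at hxI hyI
    push_cast at hxI hyI
    rw [Real.dist_eq, abs_le]
    constructor <;> linarith [hxI.1, hxI.2, hyI.1, hyI.2]
  have hdisj : B.PairwiseDisjoint fun k => I k \ K := fun i _ j _ hij =>
    (pairwise_disjoint_Ico_zsmul r hij).mono sdiff_subset sdiff_subset
  have hmul : ENNReal.ofReal η * volume (⋃ k ∈ B, I k) ≤ ENNReal.ofReal η * t := calc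
    _ ≤ ENNReal.ofReal η * ∑' k : B, volume (I k) := by
      gcongr; exact measure_biUnion_le _ B.to_countable _
    _ = ∑' k : B, ENNReal.ofReal (η * r) := by
      simp only [hvol, ENNReal.ofReal_mul hη.le, ENNReal.tsum_mul_left]
    _ ≤ ∑' k : B, volume (I k \ K) := ENNReal.tsum_le_tsum fun k => k.2.1.le
    _ = volume (⋃ k ∈ B, I k \ K) :=
      (measure_biUnion B.to_countable hdisj fun k _ => measurableSet_Ico.diff hK.measurableSet).symm
    _ ≤ volume (Metric.cthickening r K \ K) := measure_mono hthick
    _ = volume (Metric.cthickening r K) - volume K :=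
      measure_sdiff (Metric.self_subset_cthickening K) hK.measurableSet.nullMeasurableSet
        hK.measure_lt_top.ne
    _ ≤ _ := tsub_le_iff_left.2 hr.le
  exact (measure_mono hcover).trans
    ((ENNReal.mul_le_mul_iff_right (by simpa using hη) ENNReal.ofReal_ne_top).1 hmul)

/-- A compact set `K` contains a slightly smaller compact set `K'` such that every subset of `K'`
of nearly full measure has density almost `1 / 2`, at a small scale, at every point of `K'`. -/
theorem exists_isCompact_subset_density_stable {K : Set ℝ} (hK : IsCompact K) {t : ℝ≥0∞}
    (ht : t ≠ 0) {η : ℝ} (hη : 0 < η) :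
    ∃ (K' : Set ℝ) (t' : ℝ≥0∞), K' ⊆ K ∧ IsCompact K' ∧ t' ≠ 0 ∧ volume (K \ K') + t' ≤ t ∧
      ∀ P, volume (K' \ P) ≤ t' → ∀ x ∈ K', ∃ h : ℝ, 0 < h ∧ h < η ∧
        ENNReal.ofReal ((1 - 2 * η) * h) ≤ volume (P ∩ Icc (x - h) (x + h)) := by
  obtain ⟨r, hr0, hrη, hle⟩ :=
    exists_grid_volume_diff_le hK (ENNReal.half_pos ht).ne' hη
  set G : Set ℤ := {k : ℤ | volume (Ico (k • r) ((k + 1) • r) \ K) ≤ ENNReal.ofReal (η * r)}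
  have hclosed : IsClosed (⋃ k ∈ G, Icc (k • r) ((k + 1) • r)) := by
    have hlf : LocallyFinite fun k : ℤ => Icc (k • r) ((k + 1) • r) := by
      intro x
      refine ⟨Ioo (x - r) (x + r), Ioo_mem_nhds (by linarith) (by linarith),
        (finite_Icc (⌊x / r⌋ - 2) (⌊x / r⌋ + 2)).subset ?_⟩
      rintro k ⟨y, hyk, hyx⟩
      simp only [mem_Icc, mem_Ioo, zsmul_eq_mul] at hyk hyx
      push_cast at hyk
      have h1 : (k : ℝ) < x / r + 1 := by
        rw [← sub_lt_iff_lt_add, lt_div_iff₀ hr0]; linarith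
      have h2 : x / r < k + 2 := by
        rw [div_lt_iff₀ hr0]; linarith
      have h3 := Int.floor_le (x / r)
      have h4 := Int.lt_floor_add_one (x / r)
      have h5 : k < ⌊x / r⌋ + 2 := by exact_mod_cast (by linarith : (k : ℝ) < ⌊x / r⌋ + 2)
      have h6 : ⌊x / r⌋ < k + 2 := by exact_mod_cast (by linarith : (⌊x / r⌋ : ℝ) < k + 2)
      constructor <;> omega
    rw [biUnion_eq_iUnion]
    exact (hlf.comp_injective Subtype.val_injective).isClosed_iUnion fun _ => isClosed_Icc
  refine ⟨K ∩ ⋃ k ∈ G, Icc (k • r) ((k + 1) • r), min (t / 2) (ENNReal.ofReal (η * r)),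
    inter_subset_left, hK.inter_right hclosed, ?_, ?_, ?_⟩
  · exact (lt_min (ENNReal.half_pos ht) (by simp; positivity)).ne'
  · rw [sdiff_self_inter]
    exact (add_le_add hle (min_le_left _ _)).trans (ENNReal.add_halves t).le
  · rintro P hP x ⟨-, hx⟩
    obtain ⟨k, hk, hxk⟩ := mem_iUnion₂.1 hx
    refine ⟨r, hr0, hrη, ?_⟩
    set I := Ico (k • r) ((k + 1) • r) with hI
    have hIx : I ⊆ Icc (x - r) (x + r) := by
      intro y hy
      simp only [hI, mem_Ico, mem_Icc, zsmul_eq_mul] at hy hxk ⊢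
      push_cast at hy hxk
      constructor <;> linarith [hy.1, hy.2, hxk.1, hxk.2]
    have hcov : I ⊆ (P ∩ Icc (x - r) (x + r)) ∪ ((I \ K) ∪
        ((K ∩ ⋃ k ∈ G, Icc (k • r) ((k + 1) • r)) \ P)) := by
      intro y hy
      by_cases hyP : y ∈ P
      · exact .inl ⟨hyP, hIx hy⟩
      by_cases hyK : y ∈ K
      · exact .inr (.inr ⟨⟨hyK, mem_biUnion hk (Ico_subset_Icc_self hy)⟩, hyP⟩)
      · exact .inr (.inl ⟨hy, hyK⟩)
    have hvol : volume I = ENNReal.ofReal r := by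
      rw [hI, Real.volume_Ico]; congr 1; simp only [zsmul_eq_mul]; push_cast; ring
    have hsum : ENNReal.ofReal r ≤ volume (P ∩ Icc (x - r) (x + r)) +
        ENNReal.ofReal (2 * η * r) := calc
      _ ≤ _ := hvol ▸ (measure_mono hcov).trans (measure_union_le _ _)
      _ ≤ volume (P ∩ Icc (x - r) (x + r)) +
          (ENNReal.ofReal (η * r) + ENNReal.ofReal (η * r)) := by
        gcongr
        exact (measure_union_le _ _).trans (add_le_add hk (hP.trans (min_le_right _ _)))
      _ = _ := by
        rw [← ENNReal.ofReal_add (by positivity) (by positivity)]; congr 2; ring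
    rw [show (1 - 2 * η) * r = r - 2 * η * r by ring, ENNReal.ofReal_sub _ (by positivity)]
    exact tsub_le_iff_right.2 hsum

/-- Every compact set contains, up to small measure, a compact set with density almost `1 / 2` at
arbitrarily small scales at each of its points. -/
theorem exists_isCompact_subset_half_density {K : Set ℝ} (hK : IsCompact K) {t : ℝ≥0∞}
    (ht : t ≠ 0) :
    ∃ P ⊆ K, IsCompact P ∧ volume (K \ P) ≤ t ∧ ∀ x ∈ P, ∀ η : ℝ, 0 < η → ∃ h : ℝ, 0 < h ∧ h < η ∧
      ENNReal.ofReal ((1 - 2 * η) * h) ≤ volume (P ∩ Icc (x - h) (x + h)) := by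
  let S := {p : Set ℝ × ℝ≥0∞ // IsCompact p.1 ∧ p.2 ≠ 0}
  have step : ∀ (n : ℕ) (p : S), ∃ q : S, q.1.1 ⊆ p.1.1 ∧
      volume (p.1.1 \ q.1.1) + q.1.2 ≤ p.1.2 ∧
      ∀ P, volume (q.1.1 \ P) ≤ q.1.2 → ∀ x ∈ q.1.1, ∃ h : ℝ, 0 < h ∧ h < 1 / ((n : ℝ) + 1) ∧
        ENNReal.ofReal ((1 - 2 * (1 / ((n : ℝ) + 1))) * h) ≤
          volume (P ∩ Icc (x - h) (x + h)) := by
    rintro n ⟨⟨L, s⟩, hL, hs⟩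
    obtain ⟨L', s', hsub, hL', hs', hle, hd⟩ := exists_isCompact_subset_density_stable hL hs
      (Nat.one_div_pos_of_nat (α := ℝ) (n := n))
    exact ⟨⟨(L', s'), hL', hs'⟩, hsub, hle, hd⟩
  choose next hsub hle hd using step
  let u : ℕ → S := fun n => Nat.rec ⟨(K, t), hK, ht⟩ next n
  have hanti : Antitone fun n => (u n).1.1 := antitone_nat_of_succ_le fun n => hsub n (u n)
  have htele : ∀ n m, volume ((u n).1.1 \ (u (n + m)).1.1) + (u (n + m)).1.2 ≤ (u n).1.2 := by
    intro n m
    induction m with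
    | zero => simp
    | succ m ih =>
      calc volume ((u n).1.1 \ (u (n + (m + 1))).1.1) + (u (n + (m + 1))).1.2
          ≤ (volume ((u n).1.1 \ (u (n + m)).1.1) +
              volume ((u (n + m)).1.1 \ (u (n + m + 1)).1.1)) + (u (n + m + 1)).1.2 := by
            gcongr
            · exact (measure_mono (sdiff_triangle _ _ _)).trans (measure_union_le _ _)
            · exact le_rfl
        _ ≤ volume ((u n).1.1 \ (u (n + m)).1.1) + (u (n + m)).1.2 := by
            rw [add_assoc]; gcongr; exact hle (n + m) (u (n + m))
        _ ≤ _ := ih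
  have hlim : ∀ n, volume ((u n).1.1 \ ⋂ m, (u m).1.1) ≤ (u n).1.2 := by
    intro n
    have hmono : Monotone fun m => (u n).1.1 \ (u m).1.1 :=
      fun i j hij => sdiff_subset_sdiff_right (hanti hij)
    rw [sdiff_iInter, hmono.measure_iUnion]
    exact iSup_le fun m => (measure_mono (hmono (Nat.le_add_left m n))).trans
      (le_self_add.trans (htele n m))
  refine ⟨⋂ m, (u m).1.1, iInter_subset _ 0, ?_, hlim 0, ?_⟩
  · exact hK.of_isClosed_subset (isClosed_iInter fun m => (u m).2.1.isClosed) (iInter_subset _ 0)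
  · intro x hx η hη
    obtain ⟨n, hn⟩ := exists_nat_one_div_lt hη
    obtain ⟨h, h0, hh, hden⟩ := hd n (u n) _ (hlim (n + 1)) x (mem_iInter.1 hx (n + 1))
    refine ⟨h, h0, hh.trans hn, le_trans ?_ hden⟩
    gcongr

theorem half_le_upperDensity {P : Set ℝ} {x : ℝ}
    (hP : ∀ η : ℝ, 0 < η → ∃ h : ℝ, 0 < h ∧ h < η ∧
      ENNReal.ofReal ((1 - 2 * η) * h) ≤ volume (P ∩ Icc (x - h) (x + h))) :
    (1 / 2 : ℝ≥0∞) ≤ upperDensity P x := by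
  refine le_of_forall_lt_imp_le_of_dense fun c hc => ?_
  lift c to NNReal using hc.ne_top
  have hc' : (c : ℝ) < 1 / 2 := by
    have := (ENNReal.toReal_lt_toReal ENNReal.coe_ne_top (by simp)).2 hc
    simpa using this
  refine le_limsup_of_frequently_le (frequently_iff.2 fun {U} hU => ?_)
  obtain ⟨δ, hδ, hδU⟩ := mem_nhdsGT_iff_exists_Ioo_subset.1 hU
  have hη : 0 < min δ (1 / 2 - c) := lt_min hδ (by linarith)
  obtain ⟨h, h0, hh, hden⟩ := hP _ hη
  refine ⟨h, hδU ⟨h0, hh.trans_le (min_le_left _ _)⟩, ?_⟩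
  rw [ENNReal.le_div_iff_mul_le (by simp [h0]) (.inl ENNReal.ofReal_ne_top)]
  refine le_trans ?_ hden
  rw [← ENNReal.ofReal_coe_nnreal, ← ENNReal.ofReal_mul c.coe_nonneg]
  refine ENNReal.ofReal_le_ofReal ?_
  nlinarith [min_le_right δ (1 / 2 - (c : ℝ))]

theorem stmt_5 (A : Set ℝ) (hA : MeasurableSet A) (h0 : 0 < volume A)
    (hfin : volume A < ⊤) :
    ∀ ε : ℝ, 0 < ε → ∃ P, P ⊆ A ∧ IsCompact P ∧
      volume (A \ P) < ENNReal.ofReal ε ∧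
      ∀ x ∈ P, (1 / 2 : ℝ≥0∞) ≤ upperDensity P x := by
  intro ε hε
  have hε' : ENNReal.ofReal ε / 2 ≠ 0 := by simpa using hε
  obtain ⟨K, hKA, hK, hAK⟩ := hA.exists_isCompact_sdiff_lt hfin.ne hε'
  obtain ⟨P, hPK, hP, hKP, hd⟩ := exists_isCompact_subset_half_density hK hε'
  refine ⟨P, hPK.trans hKA, hP, ?_, fun x hx => half_le_upperDensity (hd x hx)⟩
  calc volume (A \ P) ≤ volume (A \ K) + volume (K \ P) :=
        (measure_mono (sdiff_triangle _ _ _)).trans (measure_union_le _ _)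
    _ < ENNReal.ofReal ε / 2 + ENNReal.ofReal ε / 2 :=
        ENNReal.add_lt_add_of_lt_of_le (hKP.trans_lt (by finiteness)).ne hAK hKP
    _ = ENNReal.ofReal ε := ENNReal.add_halves _
end

section
/- Suppose A ⊆ ℝ is Lebesgue measurable, F ⊆ A is compact, and the upper density of A is positive at every point of F (d̄(A,x) > 0 for all x ∈ F). Then there exists a compact set P with F ⊆ P ⊆ A such that the upper density of P is positive at every point of P (d̄(P,x) > 0 for all x ∈ P). -/
open MeasureTheory Filter Set
open scoped Pointwise ENNReal Topology

/-- Positivity of the upper density, with the `limsup` unfolded. -/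
lemma upperDensity_pos_iff {B : Set ℝ} {x : ℝ} :
    0 < upperDensity B x ↔ ∃ c : ℝ, 0 < c ∧ ∀ δ > 0, ∃ h, 0 < h ∧ h < δ ∧
      ENNReal.ofReal (c * h) ≤ volume (B ∩ Icc (x - h) (x + h)) := by
  constructor
  · intro hpos
    obtain ⟨c, hc0, hc⟩ := exists_between hpos
    have hfr := frequently_lt_of_lt_limsup (by isBoundedDefault) hc
    have hctop : c ≠ ∞ := hc.ne_top
    refine ⟨c.toReal * 2, mul_pos (ENNReal.toReal_pos hc0.ne' hctop) two_pos, fun δ hδ => ?_⟩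
    obtain ⟨h, hch, hh0, hhδ⟩ := (hfr.and_eventually (Ioo_mem_nhdsGT hδ)).exists
    refine ⟨h, hh0, hhδ, ?_⟩
    rw [mul_assoc, ENNReal.ofReal_mul ENNReal.toReal_nonneg, ENNReal.ofReal_toReal hctop]
    exact ENNReal.mul_le_of_le_div hch.le
  · rintro ⟨c, hc, H⟩
    have hpos : 0 < ENNReal.ofReal (c / 2) := ENNReal.ofReal_pos.2 (half_pos hc)
    refine hpos.trans_le (le_limsup_of_frequently_le ?_ (by isBoundedDefault))
    rw [(nhdsGT_basis (0 : ℝ)).frequently_iff]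
    intro δ hδ
    obtain ⟨h, h0, hδ, hh⟩ := H δ hδ
    refine ⟨h, ⟨h0, hδ⟩, ?_⟩
    have h2 : 0 < 2 * h := by positivity
    rw [ENNReal.le_div_iff_mul_le (Or.inl (ENNReal.ofReal_pos.2 h2).ne')
      (Or.inl ENNReal.ofReal_ne_top), ← ENNReal.ofReal_mul (half_pos hc).le]
    convert hh using 2
    ring

lemma upperDensity_pos_mono {B C : Set ℝ} (hBC : B ⊆ C) {x : ℝ} (h : 0 < upperDensity B x) :
    0 < upperDensity C x := by
  obtain ⟨c, hc, H⟩ := upperDensity_pos_iff.1 h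
  refine upperDensity_pos_iff.2 ⟨c, hc, fun δ hδ => ?_⟩
  obtain ⟨r, h0, h1, h2⟩ := H δ hδ
  exact ⟨r, h0, h1, h2.trans (by gcongr)⟩

/-- A set contains, up to a null set, a measurable set which has large density at small
scales around each of its own points. -/
lemma exists_measurableSet_large_density {B : Set ℝ} (hB : MeasurableSet B) :
    ∃ E ⊆ B, MeasurableSet E ∧ volume (B \ E) = 0 ∧ ∀ x ∈ E, ∀ᶠ r in 𝓝[>] (0 : ℝ),
      ENNReal.ofReal r < volume (E ∩ Ioo (x - r) (x + r)) := by
  have hae := Besicovitch.ae_tendsto_measure_inter_div_of_measurableSet (volume : Measure ℝ) hB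
  set N : Set ℝ := toMeasurable volume {x | ¬ Tendsto
    (fun r => volume (B ∩ Metric.closedBall x r) / volume (Metric.closedBall x r)) (𝓝[>] 0)
    (𝓝 (B.indicator 1 x))} with hN
  have hN0 : volume N = 0 := by rw [hN, measure_toMeasurable]; exact ae_iff.1 hae
  refine ⟨B \ N, sdiff_subset, hB.diff (measurableSet_toMeasurable _ _), ?_, ?_⟩
  · rw [sdiff_sdiff_right_self]
    exact measure_mono_null inter_subset_right hN0
  · rintro x ⟨hxB, hxN⟩
    have hx : Tendsto
        (fun r => volume (B ∩ Metric.closedBall x r) / volume (Metric.closedBall x r)) (𝓝[>] 0)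
        (𝓝 (B.indicator 1 x)) := by
      by_contra hcon
      exact hxN (subset_toMeasurable _ _ hcon)
    rw [indicator_of_mem hxB, Pi.one_apply] at hx
    have hhalf : (2⁻¹ : ℝ≥0∞) < 1 := by simp
    filter_upwards [hx.eventually (lt_mem_nhds hhalf), self_mem_nhdsWithin] with r hr hr0
    have hr0 : 0 < r := hr0
    have h1 : volume ((B \ N) ∩ Ioo (x - r) (x + r)) = volume (B ∩ Metric.closedBall x r) := by
      rw [Real.closedBall_eq_Icc]
      refine measure_congr (Filter.EventuallyEq.inter ?_ Ioo_ae_eq_Icc)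
      exact sdiff_null_ae_eq_self hN0
    rw [h1]
    have h2 := ENNReal.mul_lt_of_lt_div hr
    rw [Real.volume_closedBall, ENNReal.ofReal_mul zero_le_two, ← mul_assoc,
      ENNReal.ofReal_ofNat, ENNReal.inv_mul_cancel two_ne_zero ENNReal.ofNat_ne_top, one_mul] at h2
    exact h2

lemma exists_compact_enlargement {E K U : Set ℝ} (hE : MeasurableSet E)
    (hd : ∀ x ∈ E, ∀ᶠ r in 𝓝[>] (0 : ℝ), ENNReal.ofReal r < volume (E ∩ Ioo (x - r) (x + r)))
    (hK : IsCompact K) (hKE : K ⊆ E) (hU : IsOpen U) (hKU : K ⊆ U) {η : ℝ} (hη : 0 < η) :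
    ∃ K' U' : Set ℝ, (IsCompact K' ∧ K' ⊆ E ∧ IsOpen U' ∧ K' ⊆ U') ∧ K ⊆ K' ∧ U' ⊆ U ∧
      ∀ y ∈ closure U', ∃ h, 0 < h ∧ h < η ∧
        ENNReal.ofReal h ≤ volume (K' ∩ Icc (y - 2 * h) (y + 2 * h)) := by
  have hex : ∀ x ∈ K, ∃ r, 0 < r ∧ r < η ∧ Ioo (x - r) (x + r) ⊆ U ∧
      ENNReal.ofReal r < volume (E ∩ Ioo (x - r) (x + r)) := by
    intro x hx
    obtain ⟨ε, hε, hball⟩ := Metric.isOpen_iff.1 hU x (hKU hx)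
    obtain ⟨r, hr, hr0, hrη⟩ :=
      ((hd x (hKE hx)).and (Ioo_mem_nhdsGT (lt_min hη hε))).exists
    refine ⟨r, hr0, hrη.trans_le (min_le_left _ _), ?_, hr⟩
    rw [← Real.ball_eq_Ioo]
    exact (Metric.ball_subset_ball (hrη.le.trans (min_le_right _ _))).trans hball
  have hex' : ∀ x ∈ K, ∃ r, ∃ C : Set ℝ, 0 < r ∧ r < η ∧ Ioo (x - r) (x + r) ⊆ U ∧
      C ⊆ E ∩ Ioo (x - r) (x + r) ∧ IsCompact C ∧ ENNReal.ofReal r < volume C := by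
    intro x hx
    obtain ⟨r, h0, h1, h2, h3⟩ := hex x hx
    obtain ⟨C, hC, hCc, hCv⟩ := (hE.inter measurableSet_Ioo).exists_lt_isCompact h3
    exact ⟨r, C, h0, h1, h2, hC, hCc, hCv⟩
  choose! r C h0 h1 h2 hC hCc hCv using hex'
  obtain ⟨t, htK, htc⟩ := hK.elim_nhds_subcover (fun x => Ioo (x - r x) (x + r x))
    (fun x hx => Ioo_mem_nhds (by linarith [h0 x hx]) (by linarith [h0 x hx]))
  refine ⟨K ∪ ⋃ x ∈ t, C x, ⋃ x ∈ t, Ioo (x - r x) (x + r x), ⟨?_, ?_, ?_, ?_⟩,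
    subset_union_left, ?_, ?_⟩
  · exact hK.union (t.isCompact_biUnion fun x hx => hCc x (htK x hx))
  · exact union_subset hKE (iUnion₂_subset fun x hx => (hC x (htK x hx)).trans inter_subset_left)
  · exact isOpen_biUnion fun x _ => isOpen_Ioo
  · exact union_subset htc
      (iUnion₂_mono fun x hx => (hC x (htK x hx)).trans inter_subset_right)
  · exact iUnion₂_subset fun x hx => h2 x (htK x hx)
  · intro y hy
    rw [t.closure_biUnion] at hy
    obtain ⟨x, hx, hyx⟩ := mem_iUnion₂.1 hy
    have hyI := closure_minimal Ioo_subset_Icc_self isClosed_Icc hyx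
    refine ⟨r x, h0 x (htK x hx), h1 x (htK x hx), (hCv x (htK x hx)).le.trans
      (measure_mono fun z hz => ⟨Or.inr (mem_biUnion hx hz), ?_⟩)⟩
    have hz' := (hC x (htK x hx) hz).2
    constructor <;> linarith [hz'.1, hz'.2, hyI.1, hyI.2]

/-- A measurable set of finite measure is approximated from inside by compact sets with positive
upper density at each of their points. -/
lemma exists_compact_upperDensity_pos {B : Set ℝ} (hB : MeasurableSet B) (hBfin : volume B ≠ ∞)
    {ε : ℝ≥0∞} (hε : ε ≠ 0) :
    ∃ K ⊆ B, IsCompact K ∧ volume (B \ K) ≤ ε ∧ ∀ x ∈ K, 0 < upperDensity K x := by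
  have hε2 : ε / 2 ≠ 0 := (ENNReal.half_pos hε).ne'
  obtain ⟨B', hB'B, hB'c, hB'v⟩ := hB.exists_isCompact_sdiff_lt hBfin hε2
  obtain ⟨E, hEB', hE, hE0, hd⟩ := exists_measurableSet_large_density hB'c.measurableSet
  have hEfin : volume E ≠ ∞ := measure_ne_top_of_subset (hEB'.trans hB'B) hBfin
  obtain ⟨K₀, hK₀E, hK₀c, hK₀v⟩ := hE.exists_isCompact_sdiff_lt hEfin hε2
  let S := {s : Set ℝ × Set ℝ // IsCompact s.1 ∧ s.1 ⊆ E ∧ IsOpen s.2 ∧ s.1 ⊆ s.2}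
  have step : ∀ (n : ℕ) (s : S), ∃ s' : S, s.1.1 ⊆ s'.1.1 ∧ s'.1.2 ⊆ s.1.2 ∧
      ∀ y ∈ closure s'.1.2, ∃ h, 0 < h ∧ h < 1 / ((n : ℝ) + 1) ∧
        ENNReal.ofReal h ≤ volume (s'.1.1 ∩ Icc (y - 2 * h) (y + 2 * h)) := by
    rintro n ⟨⟨K, U⟩, hK, hKE, hU, hKU⟩
    obtain ⟨K', U', hs, h1, h2, h3⟩ := exists_compact_enlargement hE hd hK hKE hU hKU
      (Nat.one_div_pos_of_nat (α := ℝ) (n := n))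
    exact ⟨⟨(K', U'), hs⟩, h1, h2, h3⟩
  choose next hnext1 hnext2 hnext3 using step
  let s : ℕ → S := fun n => Nat.rec ⟨(K₀, univ), hK₀c, hK₀E, isOpen_univ, subset_univ _⟩ next n
  have hmono : Monotone fun n => (s n).1.1 := monotone_nat_of_le_succ fun n => hnext1 n (s n)
  have hanti : Antitone fun n => (s n).1.2 := antitone_nat_of_succ_le fun n => hnext2 n (s n)
  have hP : ∀ n, (⋃ m, (s m).1.1) ⊆ (s n).1.2 := by
    intro n
    refine iUnion_subset fun m => ?_
    exact (hmono (le_max_left m n)).trans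
      ((s (max m n)).2.2.2.2.trans (hanti (le_max_right m n)))
  have hPB : closure (⋃ m, (s m).1.1) ⊆ B' :=
    closure_minimal (iUnion_subset fun m => (s m).2.2.1.trans hEB') hB'c.isClosed
  refine ⟨closure (⋃ m, (s m).1.1), hPB.trans hB'B, hB'c.of_isClosed_subset isClosed_closure hPB,
    ?_, ?_⟩
  · have hK₀P : K₀ ⊆ closure (⋃ m, (s m).1.1) :=
      (subset_iUnion (fun m => (s m).1.1) 0).trans subset_closure
    calc volume (B \ closure (⋃ m, (s m).1.1))
        ≤ volume ((B \ B') ∪ ((B' \ E) ∪ (E \ K₀))) := by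
          refine measure_mono fun x hx => ?_
          have : x ∉ K₀ := fun h => hx.2 (hK₀P h)
          have := hx.1
          simp only [mem_union, Set.mem_sdiff]
          tauto
      _ ≤ volume (B \ B') + (volume (B' \ E) + volume (E \ K₀)) :=
          (measure_union_le _ _).trans (by gcongr; exact measure_union_le _ _)
      _ ≤ ε / 2 + (0 + ε / 2) := by gcongr; exact hE0.le
      _ = ε := by rw [zero_add, ENNReal.add_halves]
  · intro y hy
    refine upperDensity_pos_iff.2 ⟨1 / 2, by norm_num, fun δ hδ => ?_⟩
    obtain ⟨n, hn⟩ := exists_nat_one_div_lt (half_pos hδ)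
    obtain ⟨h, h0, h1, h2⟩ := hnext3 n (s n) y (closure_mono (hP (n + 1)) hy)
    refine ⟨2 * h, by positivity, by linarith, ?_⟩
    rw [show 1 / 2 * (2 * h) = h by ring]
    refine h2.trans (measure_mono (inter_subset_inter_left _ ?_))
    exact (subset_iUnion (fun m => (s m).1.1) (n + 1)).trans subset_closure

theorem stmt_6 (A F : Set ℝ) (hA : MeasurableSet A) (hF : IsCompact F)
    (hFA : F ⊆ A) (hd : ∀ x ∈ F, 0 < upperDensity A x) :
    ∃ P, F ⊆ P ∧ P ⊆ A ∧ IsCompact P ∧ ∀ x ∈ P, 0 < upperDensity P x := by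
  rcases F.eq_empty_or_nonempty with rfl | hne
  · exact ⟨∅, Subset.rfl, empty_subset _, isCompact_empty, by simp⟩
  have hcont : Continuous fun x : ℝ => Metric.infDist x F := Metric.continuous_infDist_pt F
  have hbdd : ∀ a ≤ (1 : ℝ), {x | Metric.infDist x F ≤ a} ⊆ Metric.cthickening 1 F := by
    intro a ha x hx
    obtain ⟨y, hy, hxy⟩ := hF.exists_infDist_eq_dist hne x
    exact Metric.mem_cthickening_of_dist_le x y 1 F hy (hxy ▸ le_trans hx ha)
  have hpow : ∀ n : ℕ, (1 / 2 : ℝ) ^ n ≤ 1 := fun n => pow_le_one₀ (by norm_num) (by norm_num)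
  let L : ℕ → Set ℝ := fun n =>
    A ∩ {x | (1 / 2 : ℝ) ^ (n + 1) < Metric.infDist x F ∧ Metric.infDist x F ≤ (1 / 2 : ℝ) ^ n}
  have hL : ∀ n, MeasurableSet (L n) := fun n =>
    hA.inter ((measurableSet_lt measurable_const hcont.measurable).inter
      (measurableSet_le hcont.measurable measurable_const))
  have hLfin : ∀ n, volume (L n) ≠ ∞ := fun n =>
    measure_ne_top_of_subset (fun x hx => hbdd _ (hpow n) hx.2.2)
      hF.cthickening.measure_lt_top.ne
  have hK : ∀ n, ∃ K ⊆ L n, IsCompact K ∧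
      volume (L n \ K) ≤ ENNReal.ofReal ((1 / 8 : ℝ) ^ n) ∧ ∀ x ∈ K, 0 < upperDensity K x :=
    fun n => exists_compact_upperDensity_pos (hL n) (hLfin n)
      (ENNReal.ofReal_pos.2 (by positivity)).ne'
  choose K hKL hKc hKv hKd using hK
  have hPeq : F ∪ ⋃ n, K n =
      ⋂ N : ℕ, ({x | Metric.infDist x F ≤ (1 / 2 : ℝ) ^ N} ∪ ⋃ n ∈ Finset.range N, K n) := by
    ext x
    simp only [mem_union, mem_iUnion, mem_iInter, mem_ofPred_eq, Finset.mem_range, exists_prop]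
    constructor
    · rintro (hx | ⟨n, hn⟩) N
      · left
        rw [Metric.infDist_zero_of_mem hx]
        positivity
      · rcases lt_or_ge n N with h | h
        · exact Or.inr ⟨n, h, hn⟩
        · exact Or.inl ((hKL n hn).2.2.trans
            (pow_le_pow_of_le_one (by norm_num) (by norm_num) h))
    · intro H
      by_cases hx : ∃ n, x ∈ K n
      · exact Or.inr hx
      · left
        have hle : ∀ N : ℕ, Metric.infDist x F ≤ (1 / 2 : ℝ) ^ N := fun N =>
          (H N).resolve_right fun ⟨n, _, hn⟩ => hx ⟨n, hn⟩
        have h0 : Metric.infDist x F ≤ 0 := ge_of_tendsto'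
          (tendsto_pow_atTop_nhds_zero_of_lt_one (by norm_num) (by norm_num)) hle
        exact (hF.isClosed.mem_iff_infDist_zero hne).2 (le_antisymm h0 Metric.infDist_nonneg)
  have hPclosed : IsClosed (F ∪ ⋃ n, K n) := by
    rw [hPeq]
    exact isClosed_iInter fun N => (isClosed_le hcont continuous_const).union
      (Finset.isCompact_biUnion _ fun n _ => hKc n).isClosed
  have hPsub : F ∪ ⋃ n, K n ⊆ Metric.cthickening 1 F :=
    union_subset (Metric.self_subset_cthickening F)
      (iUnion_subset fun n x hx => hbdd _ (hpow n) (hKL n hx).2.2)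
  refine ⟨F ∪ ⋃ n, K n, subset_union_left,
    union_subset hFA (iUnion_subset fun n => (hKL n).trans inter_subset_left),
    hF.cthickening.of_isClosed_subset hPclosed hPsub, ?_⟩
  rintro x (hx | hx)
  swap
  · obtain ⟨n, hn⟩ := mem_iUnion.1 hx
    exact upperDensity_pos_mono ((subset_iUnion K n).trans subset_union_right) (hKd n x hn)
  have hloss : ∀ h : ℝ, 0 < h → h < 1 →
      volume ((A ∩ Icc (x - h) (x + h)) \ (F ∪ ⋃ n, K n)) ≤ ENNReal.ofReal (8 * h ^ 2) := by
    intro h h0 h1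
    have hsub : (A ∩ Icc (x - h) (x + h)) \ (F ∪ ⋃ n, K n) ⊆
        ⋃ n, ((L n \ K n) ∩ Icc (x - h) (x + h)) := by
      rintro y ⟨⟨hyA, hyI⟩, hyP⟩
      have hy0 : 0 < Metric.infDist y F := (hF.isClosed.notMem_iff_infDist_pos hne).1
        fun hy => hyP (Or.inl hy)
      have hyd : Metric.infDist y F ≤ h := (Metric.infDist_le_dist_of_mem hx).trans (by
        rw [Real.dist_eq, abs_le]; constructor <;> linarith [hyI.1, hyI.2])
      obtain ⟨n, hn1, hn2⟩ := exists_nat_pow_near_of_lt_one (y := (1 / 2 : ℝ)) hy0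
        (hyd.trans h1.le) (by norm_num) (by norm_num)
      exact mem_iUnion.2 ⟨n, ⟨⟨hyA, hn1, hn2⟩, fun hy => hyP (Or.inr (mem_iUnion.2 ⟨n, hy⟩))⟩,
        hyI⟩
    have hterm : ∀ n, volume ((L n \ K n) ∩ Icc (x - h) (x + h)) ≤
        ENNReal.ofReal (4 * h ^ 2 * (1 / 2) ^ n) := by
      intro n
      rcases ((L n \ K n) ∩ Icc (x - h) (x + h)).eq_empty_or_nonempty with he | ⟨y, hy, hyI⟩
      · simp [he]
      · have hyd : Metric.infDist y F ≤ h := (Metric.infDist_le_dist_of_mem hx).trans (by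
          rw [Real.dist_eq, abs_le]; constructor <;> linarith [hyI.1, hyI.2])
        have hn : (1 / 2 : ℝ) ^ (n + 1) < h := hy.1.2.1.trans_le hyd
        refine (measure_mono inter_subset_left).trans ((hKv n).trans
          (ENNReal.ofReal_le_ofReal ?_))
        rw [pow_succ] at hn
        have hp : 0 < (1 / 2 : ℝ) ^ n := by positivity
        have h8 : (1 / 8 : ℝ) ^ n = (1 / 2 : ℝ) ^ n * (1 / 2 : ℝ) ^ n * (1 / 2 : ℝ) ^ n := by
          rw [← mul_pow, ← mul_pow]; norm_num
        rw [h8]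
        exact mul_le_mul_of_nonneg_right (by nlinarith) hp.le
    have hsum : HasSum (fun n : ℕ => 4 * h ^ 2 * (1 / 2 : ℝ) ^ n) (8 * h ^ 2) := by
      have := hasSum_geometric_two.mul_left (4 * h ^ 2)
      rwa [show 4 * h ^ 2 * 2 = 8 * h ^ 2 by ring] at this
    calc volume ((A ∩ Icc (x - h) (x + h)) \ (F ∪ ⋃ n, K n))
        ≤ volume (⋃ n, ((L n \ K n) ∩ Icc (x - h) (x + h))) := measure_mono hsub
      _ ≤ ∑' n, volume ((L n \ K n) ∩ Icc (x - h) (x + h)) := measure_iUnion_le _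
      _ ≤ ∑' n, ENNReal.ofReal (4 * h ^ 2 * (1 / 2 : ℝ) ^ n) := ENNReal.tsum_le_tsum hterm
      _ = ENNReal.ofReal (8 * h ^ 2) := by
        rw [← ENNReal.ofReal_tsum_of_nonneg (fun n => by positivity) hsum.summable, hsum.tsum_eq]
  obtain ⟨c, hc, H⟩ := upperDensity_pos_iff.1 (hd x hx)
  refine upperDensity_pos_iff.2 ⟨c / 2, half_pos hc, fun δ hδ => ?_⟩
  obtain ⟨h, h0, h1, h2⟩ := H (min δ (min 1 (c / 16))) (by positivity)
  have hlt1 : h < 1 := h1.trans_le ((min_le_right _ _).trans (min_le_left _ _))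
  have hltc : h < c / 16 := h1.trans_le ((min_le_right _ _).trans (min_le_right _ _))
  refine ⟨h, h0, h1.trans_le (min_le_left _ _), ?_⟩
  have hsplit : volume (A ∩ Icc (x - h) (x + h)) ≤
      volume ((F ∪ ⋃ n, K n) ∩ Icc (x - h) (x + h)) + ENNReal.ofReal (8 * h ^ 2) := by
    refine le_trans ?_ (add_le_add_right (hloss h h0 hlt1) _)
    refine (measure_mono fun y hy => ?_).trans (measure_union_le _ _)
    by_cases hyP : y ∈ F ∪ ⋃ n, K n
    · exact Or.inl ⟨hyP, hy.2⟩
    · exact Or.inr ⟨hy, hyP⟩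
  have hle : ENNReal.ofReal (c * h - 8 * h ^ 2) ≤
      volume ((F ∪ ⋃ n, K n) ∩ Icc (x - h) (x + h)) := by
    rw [ENNReal.ofReal_sub _ (by positivity)]
    exact tsub_le_iff_right.2 (h2.trans hsplit)
  exact (ENNReal.ofReal_le_ofReal (by nlinarith)).trans hle
end

section
/- Let A ⊆ ℝ be a nowhere dense, compact, perfect set of positive Lebesgue measure. Then there exists a compact perfect set B ⊆ ℝ such that N + B ≠ A + B for every closed Lebesgue null subset N of A. -/
open MeasureTheory Set
open scoped Pointwise

/-- The perfect set theorem for Borel sets. -/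
theorem MeasurableSet.exists_perfect_nonempty_of_not_countable {X : Type*} [TopologicalSpace X]
    [PolishSpace X] [MeasurableSpace X] [BorelSpace X] {G : Set X} (hG : MeasurableSet G)
    (hunc : ¬ G.Countable) : ∃ K ⊆ G, IsCompact K ∧ Perfect K ∧ K.Nonempty := by
  obtain ⟨f, hfG, hfc, hfi⟩ :
      ∃ f : (ℕ → Bool) → X, range f ⊆ G ∧ Continuous f ∧ Function.Injective f := by
    obtain ⟨t', ht', hpol, hcl, -⟩ := hG.isClopenable
    obtain ⟨f, h₁, h₂, h₃⟩ :=
      @IsClosed.exists_nat_bool_injection_of_not_countable X t' hpol G hcl hunc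
    refine ⟨f, h₁, continuous_iff_coinduced_le.2 (le_trans ?_ ht'), h₃⟩
    exact (@continuous_iff_coinduced_le _ _ f _ t').1 h₂
  have hcomp : IsCompact (range f) := isCompact_range hfc
  have hrange : ¬ (range f).Countable := by
    intro h
    have : (univ : Set (ℕ → Bool)).Countable := by
      refine countable_of_injective_of_countable_image hfi.injOn ?_
      rwa [image_univ]
    rw [countable_univ_iff, ← Cardinal.mk_le_aleph0_iff] at this
    exact absurd this (by simpa using Cardinal.cantor Cardinal.aleph0)
  obtain ⟨D, hD, hne, hDf⟩ :=
    exists_perfect_nonempty_of_isClosed_of_not_countable hcomp.isClosed hrange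
  exact ⟨D, hDf.trans hfG, hcomp.of_isClosed_subset hD.closed hDf, hD, hne⟩

theorem Set.Countable.isMeagre {X : Type*} [TopologicalSpace X] [T1Space X] [PerfectSpace X]
    {s : Set X} (hs : s.Countable) : IsMeagre s := by
  rw [← biUnion_of_singleton s]
  refine isMeagre_biUnion hs fun x _ => IsNowhereDense.isMeagre ?_
  rw [isClosed_singleton.isNowhereDense_iff]
  exact interior_singleton x

/-- A Borel meagre set of reals can be avoided, except possibly at `0`, by a compact perfect set
containing `0`. -/
theorem IsMeagre.exists_perfect_zero_mem {M : Set ℝ} (hM : IsMeagre M) (hMm : MeasurableSet M) :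
    ∃ B : Set ℝ, IsCompact B ∧ Perfect B ∧ 0 ∈ B ∧ ∀ x ∈ B, x ∈ M → x = 0 := by
  have key (n : ℕ) : ∃ K ⊆ Ioo (0 : ℝ) (1 / (n + 1)) \ M,
      IsCompact K ∧ Perfect K ∧ K.Nonempty := by
    refine (measurableSet_Ioo.diff hMm).exists_perfect_nonempty_of_not_countable fun h => ?_
    refine not_isMeagre_of_isOpen (isOpen_Ioo (a := (0 : ℝ)) (b := 1 / (n + 1)))
      (nonempty_Ioo.2 (by positivity)) ((h.isMeagre.union hM).mono ?_)
    rw [sdiff_union_self]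
    exact subset_union_left
  choose K hKs hKc hKp hKn using key
  have hpre : Preperfect (⋃ n, K n) := by
    intro x hx
    obtain ⟨n, hn⟩ := mem_iUnion.1 hx
    exact ((hKp n).acc x hn).mono (Filter.principal_mono.2 (subset_iUnion K n))
  have hsub (n : ℕ) : closure (⋃ n, K n) ⊆ (⋃ m ∈ Finset.range n, K m) ∪ Icc 0 (1 / (n + 1)) := by
    refine closure_minimal (iUnion_subset fun m x hx => ?_)
      (((Finset.range n).finite_toSet.isClosed_biUnion fun m _ => (hKc m).isClosed).union
        isClosed_Icc)
    by_cases hmn : m < n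
    · exact Or.inl (mem_biUnion (Finset.mem_range.2 hmn) hx)
    · have h := (hKs m hx).1
      refine Or.inr ⟨h.1.le, h.2.le.trans ?_⟩
      exact Nat.one_div_le_one_div (not_lt.1 hmn)
  have hIcc : closure (⋃ n, K n) ⊆ Icc 0 1 := by simpa using hsub 0
  refine ⟨closure (⋃ n, K n), isCompact_Icc.of_isClosed_subset isClosed_closure hIcc,
    hpre.perfect_closure, ?_, fun x hx hxM => ?_⟩
  · rw [Metric.mem_closure_iff]
    intro ε hε
    obtain ⟨n, hn⟩ := exists_nat_one_div_lt hε
    obtain ⟨y, hy⟩ := hKn n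
    have h := (hKs n hy).1
    refine ⟨y, mem_iUnion.2 ⟨n, hy⟩, ?_⟩
    rw [Real.dist_eq, zero_sub, abs_neg, abs_of_pos h.1]
    exact h.2.trans hn
  · by_contra hx0
    have hpos : 0 < x := lt_of_le_of_ne (hIcc hx).1 (Ne.symm hx0)
    obtain ⟨n, hn⟩ := exists_nat_one_div_lt hpos
    rcases hsub n hx with h | h
    · obtain ⟨m, -, hm⟩ := mem_iUnion₂.1 h
      exact (hKs m hm).2 hxM
    · exact absurd h.2 (not_le.2 hn)

theorem stmt_7 (A : Set ℝ) (hnd : IsNowhereDense A) (hc : IsCompact A)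
    (hp : Perfect A) (hm : 0 < volume A) :
    ∃ B : Set ℝ, IsCompact B ∧ Perfect B ∧
      ∀ N, N ⊆ A → IsClosed N → volume N = 0 → N + B ≠ A + B := by
  obtain ⟨C, hCA, hCc, hCd⟩ :=
    (TopologicalSpace.IsSeparable.of_separableSpace A).exists_countable_dense_subset
  have hclosed (c : ℝ) : IsClosed ((fun x => c - x) ⁻¹' A) :=
    hp.closed.preimage (continuous_const.sub continuous_id)
  have hM : IsMeagre (⋃ c ∈ C, (fun x => c - x) ⁻¹' A) := by
    refine isMeagre_biUnion hCc fun c _ => IsNowhereDense.isMeagre ?_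
    rw [(hclosed c).isNowhereDense_iff]
    have h := (Homeomorph.subLeft c).preimage_interior A
    rw [hp.closed.isNowhereDense_iff.1 hnd, preimage_empty] at h
    exact h.symm
  obtain ⟨B, hBc, hBp, hB0, hB⟩ := hM.exists_perfect_zero_mem
    (MeasurableSet.biUnion hCc fun c _ => (hclosed c).measurableSet)
  refine ⟨B, hBc, hBp, fun N hNA hN hN0 hEq => ?_⟩
  have hCN : C ⊆ N := by
    intro c hcC
    have hcAB : c + 0 ∈ A + B := add_mem_add (hCA hcC) hB0
    rw [← hEq] at hcAB
    obtain ⟨a, ha, b, hb, hab⟩ := mem_add.1 hcAB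
    have hbM : b ∈ ⋃ c ∈ C, (fun x => c - x) ⁻¹' A := by
      refine mem_biUnion hcC ?_
      rw [mem_preimage, show c - b = a by linarith]
      exact hNA ha
    have hb0 := hB b hb hbM
    rwa [show c = a by linarith]
  have hAN : A ⊆ N := hCd.trans (closure_minimal hCN hN)
  exact hm.ne' (measure_mono_null hAN hN0)
end

section
/- Let B ⊆ ℝ be a closed set, and let A ⊆ ℝ be arbitrary. If every countable subset C of A can be translated into B (i.e., for every countable C ⊆ A there exists x ∈ ℝ with C + x ⊆ B), then A can be translated into B; that is, there exists x ∈ ℝ with A + x ⊆ B. -/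
open Set

theorem stmt_9 (A B : Set ℝ) (hB : IsClosed B)
    (h : ∀ C, C ⊆ A → C.Countable → ∃ x : ℝ, (fun a => a + x) '' C ⊆ B) :
    ∃ x : ℝ, (fun a => a + x) '' A ⊆ B := by
  obtain ⟨C, hCA, hC, hAC⟩ :=
    (TopologicalSpace.IsSeparable.of_separableSpace A).exists_countable_dense_subset
  obtain ⟨x, hx⟩ := h C hCA hC
  refine ⟨x, image_subset_iff.2 (hAC.trans ?_)⟩
  exact closure_minimal (image_subset_iff.1 hx) (hB.preimage (continuous_add_const x))
end

section
/- Let A and B be compact subsets of ℝ, and let N₁ ⊇ N₂ ⊇ N₃ ⊇ ⋯ be a decreasing sequence of closed subsets of A such that Nᵢ + B = A + B for every i. Then the intersection N = ⋂_{i=1}^∞ Nᵢ also satisfies N + B = A + B. -/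
open Set
open scoped Pointwise

theorem stmt_10 (A B : Set ℝ) (hA : IsCompact A) (hB : IsCompact B)
    (N : ℕ → Set ℝ) (hanti : ∀ i, N (i + 1) ⊆ N i)
    (hclosed : ∀ i, IsClosed (N i)) (hsub : ∀ i, N i ⊆ A)
    (hsum : ∀ i, N i + B = A + B) :
    (⋂ i, N i) + B = A + B := by
  refine Subset.antisymm (add_subset_add_right ((iInter_subset N 0).trans (hsub 0))) ?_
  intro x hx
  have hcl : ∀ i, IsClosed (N i ∩ (fun n => x - n) ⁻¹' B) := fun i =>
    (hclosed i).inter (hB.isClosed.preimage (by fun_prop))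
  have hne : ∀ i, (N i ∩ (fun n => x - n) ⁻¹' B).Nonempty := by
    intro i
    rw [← hsum i] at hx
    obtain ⟨n, hn, b, hb, rfl⟩ := mem_add.1 hx
    exact ⟨n, hn, by simpa using hb⟩
  obtain ⟨n, hn⟩ := IsCompact.nonempty_iInter_of_sequence_nonempty_isCompact_isClosed
    (fun i => N i ∩ (fun n => x - n) ⁻¹' B)
    (fun i => inter_subset_inter_left _ (hanti i)) hne
    (hA.of_isClosed_subset (hcl 0) (inter_subset_left.trans (hsub 0))) hcl
  rw [mem_iInter] at hn
  exact mem_add.2 ⟨n, mem_iInter.2 fun i => (hn i).1, x - n, (hn 0).2, add_sub_cancel n x⟩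
end

section
/- Let A and B be compact subsets of ℝ, and let 𝒩 be the family of all closed subsets N of A satisfying N + B = A + B. Then 𝒩 contains a minimal element with respect to set inclusion; that is, there exists a closed set N ⊆ A with N + B = A + B such that no proper closed subset N' ⊊ N satisfies N' + B = A + B. -/
open Set
open scoped Pointwise

/-- For a nonempty chain of compact sets, the sumset of the intersection with a closed set contains
the intersection of the sumsets. -/
theorem IsChain.iInter_add_subset_sInter_add {c : Set (Set ℝ)} {B : Set ℝ}
    (hc : IsChain (· ⊆ ·) c) (hne : c.Nonempty) (hcomp : ∀ s ∈ c, IsCompact s)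
    (hB : IsClosed B) : ⋂ s ∈ c, (s + B) ⊆ ⋂₀ c + B := by
  intro z hz
  rw [mem_iInter₂] at hz
  have hcl : IsClosed ((fun x : ℝ => z - x) ⁻¹' B) := hB.preimage (by fun_prop)
  have : Nonempty c := hne.to_subtype
  have hk (s : c) : IsCompact ((s : Set ℝ) ∩ (fun x : ℝ => z - x) ⁻¹' B) :=
    (hcomp s s.2).inter_right hcl
  obtain ⟨x, hx⟩ := IsCompact.nonempty_iInter_of_directed_nonempty_isCompact_isClosed
    (fun s : c => (s : Set ℝ) ∩ (fun x : ℝ => z - x) ⁻¹' B)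
    (fun s t => by
      rcases hc.total s.2 t.2 with h | h
      · exact ⟨s, subset_rfl, inter_subset_inter_left _ h⟩
      · exact ⟨t, inter_subset_inter_left _ h, subset_rfl⟩)
    (fun s => by
      obtain ⟨n, hn, b, hb, rfl⟩ := mem_add.1 (hz s s.2)
      exact ⟨n, hn, by simpa using hb⟩)
    hk (fun s => (hk s).isClosed)
  rw [mem_iInter] at hx
  obtain ⟨s, hs⟩ := hne
  exact mem_add.2 ⟨x, fun t ht => (hx ⟨t, ht⟩).1, z - x, (hx ⟨s, hs⟩).2, by ring⟩

theorem stmt_11 (A B : Set ℝ) (hA : IsCompact A) (hB : IsCompact B) :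
    ∃ N, N ⊆ A ∧ IsClosed N ∧ N + B = A + B ∧
      ∀ N', N' ⊂ N → IsClosed N' → N' + B ≠ A + B := by
  obtain ⟨N, hNA, hN⟩ := zorn_superset_nonempty
    {N : Set ℝ | N ⊆ A ∧ IsClosed N ∧ N + B = A + B}
    (fun c hcS hc hne => by
      obtain ⟨s, hs⟩ := hne
      have hsub : ⋂₀ c ⊆ A := (sInter_subset_of_mem hs).trans (hcS hs).1
      refine ⟨⋂₀ c, ⟨hsub, isClosed_sInter fun t ht => (hcS ht).2.1, ?_⟩,
        fun t ht => sInter_subset_of_mem ht⟩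
      refine (add_subset_add_right hsub).antisymm ?_
      exact (subset_iInter₂ fun t ht => (hcS ht).2.2.ge).trans
        (hc.iInter_add_subset_sInter_add ⟨s, hs⟩
          (fun t ht => hA.of_isClosed_subset (hcS ht).2.1 (hcS ht).1) hB.isClosed))
    A ⟨subset_rfl, hA.isClosed, rfl⟩
  exact ⟨N, hNA, hN.prop.2.1, hN.prop.2.2, fun N' hN' hcl heq =>
    hN'.2 (hN.le_of_le ⟨hN'.1.trans hNA, hcl, heq⟩ hN'.1)⟩
end
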